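/- arXiv:2210.03668 — 12 statements merged into one kernel-verified Lean document; each statement's English description precedes it below -/
import Mathlib

section
/- Let m, h, n be positive integers with gcd(n, h) = 1, let E be a set of exact divisors of m, let k ∈ E and w, x, y, z ∈ ℤ with k·w·z − (m/k)·x·y = 1, y ≥ 0, and z > 0 whenever y = 0, and set K = [[k·h·w, x],[m·h²·y, k·h·z]]. Let a, b, d be integers with a·d = n and 0 ≤ b < d. Then the matrix [[n, 0],[0, 1]]·K·[[d, −b],[0, a]] represents an element of the replicate set Γ₀((m/gcd(a,m))·h ∣ h)+E′, where E′ = {ℓ ∈ E : gcd(ℓ, gcd(a, m)) = 1}, if and only if a = gcd(n, (m/k)·y) and a·k divides m·y with z ≡ b·h·((m·y)/(a·k)) (mod d). -/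
open Matrix

/-- A rational matrix `M` *represents* an element of `Γ₀(m·h ∣ h) + E` if some
nonzero rational multiple of `M` has the form `[[k·h·w, x],[m·h²·y, k·h·z]]`
with `k ∈ E`, `w, x, y, z ∈ ℤ` and `k·w·z − (m/k)·x·y = 1`. -/
def RepresentsGamma (m h : ℕ) (E : Set ℕ) (M : Matrix (Fin 2) (Fin 2) ℚ) : Prop :=
  ∃ (c : ℚ) (k : ℕ) (w x y z : ℤ), c ≠ 0 ∧ k ∈ E ∧
    (k : ℤ) * w * z - ((m / k : ℕ) : ℤ) * x * y = 1 ∧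
    c • M = !![(k : ℚ) * h * w, (x : ℚ); (m : ℚ) * h ^ 2 * y, (k : ℚ) * h * z]

/-- Membership criterion for twisted Hecke cosets: with `K = [[khw, x],[mh²y, khz]]`
a canonical coset representative for `Γ₀(mh∣h)+E` and `H = [[a,b],[0,d]]` a Hecke
matrix of level `n` (`gcd(n,h) = 1`), the matrix `[[n,0],[0,1]]·K·[[d,−b],[0,a]]`
represents an element of the replicate `Γ₀((m/(a,m))·h ∣ h)+E′`, where
`E′ = {ℓ ∈ E : gcd(ℓ, (a,m)) = 1}`, if and only if `a = gcd(n, (m/k)·y)`,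
`a·k ∣ m·y` and `z ≡ b·h·((m·y)/(a·k)) (mod d)`. -/
theorem hecke_coset_membership (m h n : ℕ) (hm : 0 < m) (hh : 0 < h) (hn : 0 < n)
    (hnh : Nat.gcd n h = 1) (E : Set ℕ)
    (hE : ∀ k ∈ E, k ∣ m ∧ Nat.gcd k (m / k) = 1)
    (k : ℕ) (hk : k ∈ E) (w x y z : ℤ)
    (hdet : (k : ℤ) * w * z - ((m / k : ℕ) : ℤ) * x * y = 1)
    (hy : 0 ≤ y) (hz : y = 0 → 0 < z)
    (a b d : ℤ) (had : a * d = n) (hb0 : 0 ≤ b) (hbd : b < d) :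
    RepresentsGamma (m / Int.gcd a (m : ℤ)) h
        {ℓ ∈ E | Nat.gcd ℓ (Int.gcd a (m : ℤ)) = 1}
        (!![(n : ℚ), 0; 0, 1] *
          !![(k : ℚ) * h * w, (x : ℚ); (m : ℚ) * h ^ 2 * y, (k : ℚ) * h * z] *
          !![(d : ℚ), (-b : ℚ); 0, (a : ℚ)]) ↔
      (a = (Int.gcd (n : ℤ) (((m / k : ℕ) : ℤ) * y) : ℤ) ∧
        a * (k : ℤ) ∣ (m : ℤ) * y ∧
        z ≡ b * (h : ℤ) * (((m : ℤ) * y) / (a * (k : ℤ))) [ZMOD d]) := by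
  obtain ⟨hkm, -⟩ := hE k hk
  obtain ⟨q, rfl⟩ := hkm
  have hk0 : 0 < k := Nat.pos_of_mul_pos_right hm
  have hkq : k * q / k = q := Nat.mul_div_cancel_left q hk0
  rw [hkq] at hdet
  rw [hkq]
  have hd0 : 0 < d := lt_of_le_of_lt hb0 hbd
  have hn' : (0:ℤ) < n := by exact_mod_cast hn
  have ha0 : 0 < a := by
    by_contra hcon
    nlinarith
  have hgpos : 0 < Int.gcd a ((k * q : ℕ) : ℤ) := Int.gcd_pos_of_ne_zero_left _ ha0.ne'
  have hga : ((Int.gcd a ((k * q : ℕ) : ℤ) : ℕ) : ℤ) ∣ a := Int.gcd_dvd_left _ _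
  have hgm : Int.gcd a ((k * q : ℕ) : ℤ) ∣ k * q := by
    exact_mod_cast Int.gcd_dvd_right a ((k * q : ℕ) : ℤ)
  have hgreat : ∀ s : ℤ, s ∣ a → s ∣ (k:ℤ) * q → s ∣ ((Int.gcd a ((k * q : ℕ) : ℤ) : ℕ) : ℤ) := by
    intro s h1 h2
    exact Int.dvd_coe_gcd h1 (by push_cast; exact h2)
  have hlin : ∃ u v : ℤ, ((Int.gcd a ((k * q : ℕ) : ℤ) : ℕ) : ℤ) = a * u + k * q * v := by
    refine ⟨Int.gcdA a ((k * q : ℕ) : ℤ), Int.gcdB a ((k * q : ℕ) : ℤ), ?_⟩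
    have hbez := Int.gcd_eq_gcd_ab a ((k * q : ℕ) : ℤ)
    push_cast at hbez ⊢
    exact hbez
  generalize Int.gcd a ((k * q : ℕ) : ℤ) = g at *
  obtain ⟨m1, hm1⟩ := hgm
  obtain ⟨a1, ha1⟩ := hga
  have hdiv : k * q / g = m1 := by rw [hm1]; exact Nat.mul_div_cancel_left m1 hgpos
  rw [hdiv]
  have hm1Z : (k:ℤ) * q = g * m1 := by exact_mod_cast hm1
  have hm1Q : (k:ℚ) * q = g * m1 := by exact_mod_cast hm1
  have haQ : (a:ℚ) = g * a1 := by exact_mod_cast ha1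
  have hadQ : (a:ℚ) * d = n := by exact_mod_cast had
  have hhQ : (h:ℚ) ≠ 0 := by exact_mod_cast hh.ne'
  have hkQ : (k:ℚ) ≠ 0 := by exact_mod_cast hk0.ne'
  have hnQ : (n:ℚ) ≠ 0 := by exact_mod_cast hn.ne'
  have hgQ : (g:ℚ) ≠ 0 := by exact_mod_cast hgpos.ne'
  have hdQ : (d:ℚ) ≠ 0 := by exact_mod_cast hd0.ne'
  have haQ0 : (a:ℚ) ≠ 0 := by exact_mod_cast ha0.ne'
  have ha1Q0 : (a1:ℚ) ≠ 0 := by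
    intro h0; rw [h0, mul_zero] at haQ; exact haQ0 haQ
  have hm1pos : 0 < m1 := by
    rcases Nat.eq_zero_or_pos m1 with h0 | h0
    · subst h0; omega
    · exact h0
  have hm1Q0 : (m1:ℚ) ≠ 0 := by exact_mod_cast hm1pos.ne'
  have hdetQ : (k:ℚ) * w * z - q * x * y = 1 := by exact_mod_cast hdet
  constructor
  · rintro ⟨c, k', w', x', y', z', hc, ⟨hk'E, hk'g⟩, hdet', hM⟩
    have hk'm : k' ∣ k * q := (hE k' hk'E).1
    have hk'0 : 0 < k' := Nat.pos_of_dvd_of_pos hk'm hm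
    have hk'm1 : k' ∣ m1 := by
      rw [hm1] at hk'm
      exact Nat.Coprime.dvd_of_dvd_mul_left hk'g hk'm
    obtain ⟨q', hq'⟩ := hk'm1
    have hq'2 : m1 / k' = q' := by rw [hq']; exact Nat.mul_div_cancel_left q' hk'0
    rw [hq'2] at hdet'
    have hk'Q : (k':ℚ) ≠ 0 := by exact_mod_cast hk'0.ne'
    have hq'Q : (m1:ℚ) = k' * q' := by exact_mod_cast hq'
    have hdetQ' : (k':ℚ) * w' * z' - q' * x' * y' = 1 := by exact_mod_cast hdet'
    have e00 := congrFun (congrFun hM 0) 0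
    have e01 := congrFun (congrFun hM 0) 1
    have e10 := congrFun (congrFun hM 1) 0
    have e11 := congrFun (congrFun hM 1) 1
    simp [Matrix.mul_apply, Fin.sum_univ_two] at e00 e01 e10 e11
    -- the scaling factor
    have hsq : (c * n) ^ 2 * k = k' := by
      have h1 : (k':ℚ) * h ^ 2 = (c * n) ^ 2 * k * h ^ 2 := by
        calc (k':ℚ) * h ^ 2 = (k' * h * w') * (k' * h * z') - x' * (m1 * h ^ 2 * y') := by
              rw [hq'Q]; linear_combination (-(k':ℚ) * h ^ 2) * hdetQ'
          _ = (c * n) ^ 2 * k * h ^ 2 := by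
              rw [← e00, ← e01, ← e10, ← e11]
              linear_combination (c ^ 2 * n * k * h ^ 2 * a * d) * hdetQ
                + (c ^ 2 * n * k * h ^ 2) * hadQ
      have h2 : (h:ℚ) ^ 2 ≠ 0 := pow_ne_zero _ hhQ
      exact (mul_right_cancel₀ h2 h1).symm
    obtain ⟨r, hr⟩ : ∃ r : ℚ, r = c * n := ⟨_, rfl⟩
    have hr0 : r ≠ 0 := by rw [hr]; exact mul_ne_zero hc hnQ
    have hcr : c = r / n := by rw [hr]; field_simp
    rw [← hr] at hsq
    have ey : (a1:ℚ) * y' = r * y := by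
      have h2 : (h:ℚ) ^ 2 * m1 * g * d ≠ 0 := by positivity
      rw [hcr, ← hadQ] at e10
      field_simp at e10
      have h3 : r * (k * q) * y = a * m1 * y' := by linear_combination e10
      rw [hm1Q, haQ] at h3
      have h4 : (g:ℚ) * m1 ≠ 0 := mul_ne_zero hgQ hm1Q0
      apply mul_left_cancel₀ h4
      linear_combination -h3
    have ez : r * z' * n = a * z - q * h * y * b := by
      rw [← hsq, hcr] at e11
      field_simp at e11
      linear_combination -e11
    -- r is an integer
    have hcop : IsCoprime r.num (r.den : ℤ) := by
      rw [Int.isCoprime_iff_gcd_eq_one]; exact r.reduced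
    have hrd : r * r.den = r.num := Rat.mul_den_eq_num r
    have hden : (r.den : ℤ) ∣ 1 := by
      have h1 : r.num ^ 2 * (k:ℤ) = k' * (r.den:ℤ) ^ 2 := by
        have : (r.num:ℚ) ^ 2 * (k:ℚ) = k' * (r.den:ℚ) ^ 2 := by
          rw [← hrd, ← hsq]; ring
        exact_mod_cast this
      have h2 : (r.den:ℤ) ∣ k := by
        have : (r.den:ℤ) ∣ r.num ^ 2 * (k:ℤ) := by
          rw [h1]; exact Dvd.dvd.mul_left (dvd_pow_self _ two_ne_zero) _
        exact (IsCoprime.pow_right hcop.symm).dvd_of_dvd_mul_left this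
      have h3 : (r.den:ℤ) ∣ y := by
        have h4 : (a1:ℤ) * y' * r.den = r.num * y := by
          have : (a1:ℚ) * y' * r.den = r.num * y := by rw [ey, ← hrd]; ring
          exact_mod_cast this
        exact hcop.symm.dvd_of_dvd_mul_left (Dvd.intro_left _ h4)
      rw [← hdet]
      exact dvd_sub (Dvd.dvd.mul_right (Dvd.dvd.mul_right h2 _) _) (Dvd.dvd.mul_left h3 _)
    have hden1 : r.den = 1 := by
      have : r.den ∣ 1 := by exact_mod_cast hden
      exact Nat.dvd_one.mp this
    obtain ⟨s, hs⟩ : ∃ s : ℤ, r = s := ⟨r.num, by rw [← hrd, hden1]; simp⟩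
    rw [hs] at hsq ey ez
    have hsqZ : s ^ 2 * (k:ℤ) = k' := by exact_mod_cast hsq
    have eyZ : a1 * y' = s * y := by exact_mod_cast ey
    have ezZ : s * z' * n = a * z - q * h * y * b := by exact_mod_cast ez
    have hsk' : s ∣ (k':ℤ) := ⟨s * k, by rw [← hsqZ]; ring⟩
    have hk'mZ : (k':ℤ) ∣ (k:ℤ) * q := by exact_mod_cast hk'm
    have hk'gZ : IsCoprime (k':ℤ) (g:ℤ) := by exact_mod_cast (Nat.isCoprime_iff_coprime.mpr hk'g)
    have hkZ : (k:ℤ) ≠ 0 := by exact_mod_cast hk0.ne'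
    have hsq' : s ∣ (q:ℤ) := by
      obtain ⟨e, he⟩ := hk'mZ
      refine ⟨s * e, ?_⟩
      apply mul_left_cancel₀ hkZ
      rw [he, ← hsqZ]; ring
    have hsa : IsCoprime s a := by
      rw [Int.isCoprime_iff_gcd_eq_one]
      have h1 : ((Int.gcd s a : ℕ) : ℤ) ∣ s := Int.gcd_dvd_left _ _
      have h2 : ((Int.gcd s a : ℕ) : ℤ) ∣ a := Int.gcd_dvd_right _ _
      have h3 := hgreat _ h2 ((h1.trans hsq').mul_left _)
      have h4 := hk'gZ.isUnit_of_dvd' (h1.trans hsk') h3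
      simpa using Int.isUnit_iff_natAbs_eq.mp h4
    have hsz : s ∣ z := by
      apply hsa.dvd_of_dvd_mul_left
      have : a * z = s * z' * n + q * h * y * b := by rw [ezZ]; ring
      rw [this]
      exact dvd_add (Dvd.dvd.mul_right (dvd_mul_right _ _) _)
        (Dvd.dvd.mul_right (Dvd.dvd.mul_right (Dvd.dvd.mul_right hsq' _) _) _)
    have hs1 : s ∣ 1 := by
      rw [← hdet]
      exact dvd_sub (Dvd.dvd.mul_left hsz _) (Dvd.dvd.mul_right (Dvd.dvd.mul_right hsq' _) _)
    have hss : s * s = 1 := by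
      rcases Int.isUnit_iff.mp (isUnit_of_dvd_one hs1) with h1 | h1 <;> rw [h1] <;> norm_num
    have hkk : (k':ℤ) = k := by rw [← hsqZ]; linear_combination (k:ℤ) * hss
    rw [hkk] at hk'gZ
    have hgq : (g:ℤ) ∣ q := by
      apply hk'gZ.symm.dvd_of_dvd_mul_left
      exact ⟨m1, hm1Z⟩
    obtain ⟨q1, hq1⟩ := hgq
    have hyy : y = a1 * (s * y') := by linear_combination (-y) * hss - s * eyZ
    obtain ⟨Q, hQ⟩ : ∃ Q : ℤ, (q:ℤ) * y = a * Q := ⟨q1 * (s * y'), by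
      rw [hq1, ha1]; linear_combination (g * q1:ℤ) * hyy⟩
    have hzd : z = b * h * Q + d * (s * z') := by
      apply mul_left_cancel₀ ha0.ne'
      linear_combination -ezZ - (s * z') * had + (h * b) * hQ
    have hak : a * (k:ℤ) ≠ 0 := mul_ne_zero ha0.ne' hkZ
    have hmy : ((k * q : ℕ) : ℤ) * y = a * k * Q := by
      push_cast; linear_combination (k:ℤ) * hQ
    refine ⟨?_, ⟨Q, hmy⟩, ?_⟩
    · have hc1 : IsCoprime d Q := by
        rw [Int.isCoprime_iff_gcd_eq_one]
        have h1 : ((Int.gcd d Q : ℕ) : ℤ) ∣ d := Int.gcd_dvd_left _ _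
        have h2 : ((Int.gcd d Q : ℕ) : ℤ) ∣ Q := Int.gcd_dvd_right _ _
        have h3 : ((Int.gcd d Q : ℕ) : ℤ) ∣ z := by
          rw [hzd]; exact dvd_add (h2.mul_left _) (h1.mul_right _)
        have h4 : ((Int.gcd d Q : ℕ) : ℤ) ∣ 1 := by
          rw [← hdet]
          have : (q:ℤ) * x * y = a * x * Q := by linear_combination x * hQ
          rw [this]
          exact dvd_sub (h3.mul_left _) (h2.mul_left _)
        exact Nat.dvd_one.mp (by exact_mod_cast h4)
      rw [hQ, ← had, Int.gcd_mul_left, Int.isCoprime_iff_gcd_eq_one.mp hc1]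
      simp [abs_of_pos ha0]
    · rw [hmy, Int.mul_ediv_cancel_left _ hak, hzd]
      exact Int.modEq_iff_dvd.mpr ⟨-(s * z'), by ring⟩
  · rintro ⟨h1, -, h3⟩
    have hkZ : (k:ℤ) ≠ 0 := by exact_mod_cast hk0.ne'
    have hak : a * (k:ℤ) ≠ 0 := mul_ne_zero ha0.ne' hkZ
    obtain ⟨Q, hQ⟩ : a ∣ (q:ℤ) * y := by
      rw [h1]; exact Int.gcd_dvd_right _ _
    have hmy : ((k * q : ℕ) : ℤ) * y = a * k * Q := by
      push_cast; linear_combination (k:ℤ) * hQ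
    rw [hmy, Int.mul_ediv_cancel_left _ hak] at h3
    obtain ⟨e, he⟩ := Int.modEq_iff_dvd.mp h3
    have hka : IsCoprime (k:ℤ) a := ⟨w * z, -(x * Q), by linear_combination hdet + x * hQ⟩
    have hkg : IsCoprime (k:ℤ) (g:ℤ) := hka.of_isCoprime_of_dvd_right ⟨a1, ha1⟩
    have hkgN : Nat.Coprime k g := Nat.isCoprime_iff_coprime.mp hkg
    have hkm1 : k ∣ m1 := hkgN.dvd_of_dvd_mul_left ⟨q, hm1.symm⟩
    obtain ⟨q', hq'⟩ := hkm1
    have hq'2 : m1 / k = q' := by rw [hq']; exact Nat.mul_div_cancel_left q' hk0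
    have hqq : (q:ℤ) = g * q' := by
      apply mul_left_cancel₀ hkZ
      rw [hm1Z, hq']; push_cast; ring
    obtain ⟨u, v, huv⟩ := hlin
    have hgZ : (g:ℤ) ≠ 0 := by exact_mod_cast hgpos.ne'
    have hy1 : y = a1 * (u * y + k * v * Q) := by
      apply mul_left_cancel₀ hgZ
      linear_combination y * huv + (k * v) * hQ + (u * y + k * v * Q) * ha1
    obtain ⟨y', hy'⟩ : ∃ y', y = a1 * y' := ⟨_, hy1⟩
    have ha1Z : a1 ≠ 0 := by exact_mod_cast ha1Q0
    have hQ' : Q = q' * y' := by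
      apply mul_left_cancel₀ ha0.ne'
      rw [← hQ, hqq, hy', ha1]; ring
    have hQe : z = b * h * Q - d * e := by linear_combination -he
    have hQQ : (Q:ℚ) = q' * y' := by exact_mod_cast hQ'
    have hyQ : (y:ℚ) = a1 * y' := by exact_mod_cast hy'
    have hqqQ : (q:ℚ) = g * q' := by exact_mod_cast hqq
    have hzQ : (z:ℚ) = b * h * Q - d * e := by exact_mod_cast hQe
    have hm1Q' : (m1:ℚ) = k * q' := by exact_mod_cast hq'
    refine ⟨1 / n, k, w * d, a * x - k * h * w * b, y', -e, ?_, ⟨hk, hkgN⟩, ?_, ?_⟩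
    · exact one_div_ne_zero hnQ
    · rw [hq'2]
      have t1 : (q:ℤ) * y = a * q' * y' := by rw [hQ, hQ']; ring
      linear_combination hdet + x * t1 - (k * w) * hQe - (k * w * b * h) * hQ'
    · ext i j
      fin_cases i <;> fin_cases j
      · simp [Matrix.mul_apply, Fin.sum_univ_two]; field_simp
      · simp [Matrix.mul_apply, Fin.sum_univ_two]; field_simp; ring
      · simp [Matrix.mul_apply, Fin.sum_univ_two]
        rw [← hadQ, hm1Q', hyQ, hqqQ, haQ]; field_simp
      · simp [Matrix.mul_apply, Fin.sum_univ_two]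
        rw [hzQ, hQQ, hyQ, hqqQ, ← hadQ, haQ]; field_simp; ring
end

section
/- Let m, h be positive integers and E a set of exact divisors of m, and suppose that the set Γ = Γ₀(mh∣h)+E of Möbius transformations of ℍ is a group under composition. Then for every τ ∈ ℍ there is exactly one point τ′ in the Γ-orbit of τ such that: (1) Im τ′ ≥ Im Kτ′ for all K ∈ Γ; (2) −1/(2h) < Re τ′ ≤ 1/(2h); and (3) Re τ′ ≥ Re Kτ′ for every K ∈ Γ such that Kτ′ also satisfies conditions (1) and (2). -/
open UpperHalfPlane

/-- `f : ℍ → ℍ` is the Möbius transformation induced by the integer matrix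
`[[A, B],[C, D]]`. -/
def IsMoebiusOf (A B C D : ℤ) (f : UpperHalfPlane → UpperHalfPlane) : Prop :=
  ∀ τ : UpperHalfPlane,
    (f τ : ℂ) = ((A : ℂ) * (τ : ℂ) + (B : ℂ)) / ((C : ℂ) * (τ : ℂ) + (D : ℂ))

/-- The set `Γ₀(mh∣h)+E` of Möbius transformations of `ℍ` induced by integer
matrices `[[khw, x],[mh²y, khz]]` with `k ∈ E` and `kwz − (m/k)xy = 1`. -/
def GammaSet (m h : ℕ) (E : Set ℕ) : Set (UpperHalfPlane → UpperHalfPlane) :=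
  { f | ∃ (k : ℕ) (w x y z : ℤ), k ∈ E ∧
      (k : ℤ) * w * z - ((m / k : ℕ) : ℤ) * x * y = 1 ∧
      IsMoebiusOf ((k : ℤ) * (h : ℤ) * w) x ((m : ℤ) * (h : ℤ) ^ 2 * y)
        ((k : ℤ) * (h : ℤ) * z) f }

/-- A set of self-maps of `ℍ` is a group under composition. -/
def IsGroupUnderComp (Γ : Set (UpperHalfPlane → UpperHalfPlane)) : Prop :=
  id ∈ Γ ∧ (∀ f ∈ Γ, ∀ g ∈ Γ, f ∘ g ∈ Γ) ∧
    ∀ f ∈ Γ, ∃ g ∈ Γ, f ∘ g = id ∧ g ∘ f = id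

/-- The fundamental-domain conditions for `Γ` with width `1/h` at a point `τ`:
(1) `Im τ ≥ Im Kτ` for all `K ∈ Γ`; (2) `−1/(2h) < Re τ ≤ 1/(2h)`; (3)
`Re τ ≥ Re Kτ` for every `K ∈ Γ` such that `Kτ` also satisfies (1) and (2). -/
def FDConds (Γ : Set (UpperHalfPlane → UpperHalfPlane)) (h : ℕ)
    (τ : UpperHalfPlane) : Prop :=
  (∀ K ∈ Γ, (K τ).im ≤ τ.im) ∧
    (-(1 / (2 * (h : ℝ))) < τ.re ∧ τ.re ≤ 1 / (2 * (h : ℝ))) ∧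
    ∀ K ∈ Γ,
      ((∀ K' ∈ Γ, (K' (K τ)).im ≤ (K τ).im) ∧
        -(1 / (2 * (h : ℝ))) < (K τ).re ∧ (K τ).re ≤ 1 / (2 * (h : ℝ))) →
      (K τ).re ≤ τ.re

/-- Cleared-denominator form of the Moebius relation. -/
lemma moebius_eq {A B C D : ℤ} {f : UpperHalfPlane → UpperHalfPlane}
    (hf : IsMoebiusOf A B C D f) (τ : UpperHalfPlane) :
    (f τ : ℂ) * ((C : ℂ) * (τ : ℂ) + (D : ℂ)) = (A : ℂ) * (τ : ℂ) + (B : ℂ) := by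
  have h := hf τ
  have hne : ((C : ℂ) * (τ : ℂ) + (D : ℂ)) ≠ 0 := by
    intro h0
    rw [h0, div_zero] at h
    exact (f τ).ne_zero h
  rw [h]
  exact div_mul_cancel₀ _ hne

lemma moebius_im {A B C D : ℤ} {f : UpperHalfPlane → UpperHalfPlane}
    (hf : IsMoebiusOf A B C D f) (τ : UpperHalfPlane) :
    (f τ).im * ‖(C : ℂ) * (τ : ℂ) + (D : ℂ)‖ ^ 2
      = ((A : ℝ) * D - B * C) * τ.im := by
  have h := moebius_eq hf τ
  have h1 := congrArg Complex.re h
  have h2 := congrArg Complex.im h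
  rw [← Complex.normSq_eq_norm_sq, Complex.normSq_apply]
  simp only [Complex.mul_re, Complex.mul_im, Complex.add_re, Complex.add_im, Complex.intCast_re,
    Complex.intCast_im, UpperHalfPlane.coe_re, UpperHalfPlane.coe_im] at h1 h2 ⊢
  linear_combination h2 * ((C : ℝ) * τ.re + D) - h1 * ((C : ℝ) * τ.im)

lemma finite_pairs (τ : UpperHalfPlane) (M : ℝ) :
    {p : ℤ × ℤ | ‖(p.1 : ℂ) * (τ : ℂ) + (p.2 : ℂ)‖ ≤ M}.Finite := by
  have hτ := τ.im_pos
  set N : ℤ := ⌈M / τ.im⌉ with hN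
  set L : ℤ := ⌈M + (N : ℝ) * ‖(τ : ℂ)‖⌉ with hL
  refine ((Set.finite_Icc (-N) N).prod (Set.finite_Icc (-L) L)).subset ?_
  rintro ⟨c, d⟩ hp
  simp only [Set.mem_ofPred_eq] at hp
  have h1 : |(c : ℝ)| ≤ N := by
    have : |(c : ℝ)| * τ.im ≤ M := by
      refine le_trans ?_ hp
      have := Complex.abs_im_le_norm ((c : ℂ) * (τ : ℂ) + (d : ℂ))
      simpa [abs_mul, abs_of_pos hτ] using this
    exact ((le_div_iff₀ hτ).2 this).trans (Int.le_ceil _)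
  have h2 : |(d : ℝ)| ≤ L := by
    have e : ((d : ℂ)) = ((c : ℂ) * (τ : ℂ) + (d : ℂ)) - (c : ℂ) * (τ : ℂ) := by ring
    have := norm_sub_le ((c : ℂ) * (τ : ℂ) + (d : ℂ)) ((c : ℂ) * (τ : ℂ))
    rw [← e, norm_mul, Complex.norm_intCast, Complex.norm_intCast] at this
    have h3 := mul_le_mul_of_nonneg_right h1 (norm_nonneg (τ : ℂ))
    refine le_trans ?_ (Int.le_ceil _)
    linarith
  have h1' : |c| ≤ N := by exact_mod_cast h1
  have h2' : |d| ≤ L := by exact_mod_cast h2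
  exact ⟨abs_le.1 h1', abs_le.1 h2'⟩

/-- Height identity for elements of the group, with the determinant estimate. -/
lemma gamma_im_le (m h : ℕ) (hm : 0 < m) (E : Set ℕ) (hE : ∀ k ∈ E, k ∣ m)
    (τ : UpperHalfPlane) (f : UpperHalfPlane → UpperHalfPlane) (k : ℕ) (w x y z : ℤ)
    (hk : k ∈ E) (hdet : (k : ℤ) * w * z - ((m / k : ℕ) : ℤ) * x * y = 1)
    (hf : IsMoebiusOf ((k : ℤ) * (h : ℤ) * w) x ((m : ℤ) * (h : ℤ) ^ 2 * y)
        ((k : ℤ) * (h : ℤ) * z) f) :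
    (f τ).im * ‖((m * h ^ 2 * y : ℤ) : ℂ) * (τ : ℂ) + ((k * h * z : ℤ) : ℂ)‖ ^ 2
      ≤ m * h ^ 2 * τ.im := by
  have hτ := τ.im_pos
  have him := moebius_im hf τ
  have hkm : k * (m / k) = m := Nat.mul_div_cancel' (hE k hk)
  have hkle : (k : ℝ) ≤ m := by exact_mod_cast Nat.le_of_dvd hm (hE k hk)
  have hdet' : (k : ℝ) * w * z - ((m / k : ℕ) : ℝ) * x * y = 1 := by
    generalize m / k = q at hdet
    exact_mod_cast hdet
  have hkm' : (k : ℝ) * ((m / k : ℕ) : ℝ) = m := by exact_mod_cast hkm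
  have hd : (((k * h * w : ℤ) : ℝ) * ((k * h * z : ℤ) : ℝ)
      - (x : ℝ) * ((m * h ^ 2 * y : ℤ) : ℝ)) = k * h ^ 2 := by
    push_cast
    rw [← hkm']
    linear_combination (k : ℝ) * h ^ 2 * hdet'
  rw [hd] at him
  rw [him]
  gcongr

lemma norm_lower (τ : UpperHalfPlane) (C D : ℤ) (hne : (C : ℂ) * (τ : ℂ) + (D : ℂ) ≠ 0) :
    min 1 τ.im ≤ ‖(C : ℂ) * (τ : ℂ) + (D : ℂ)‖ := by
  have hτ := τ.im_pos
  by_cases hC : C = 0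
  · subst hC
    refine (min_le_left _ _).trans ?_
    have hD : D ≠ 0 := by
      rintro rfl
      simp at hne
    have : (1 : ℝ) ≤ |(D : ℝ)| := by exact_mod_cast Int.one_le_abs hD
    simpa using this
  · refine (min_le_right _ _).trans ?_
    have h1 : (1 : ℝ) ≤ |(C : ℝ)| := by exact_mod_cast Int.one_le_abs hC
    have := Complex.abs_im_le_norm ((C : ℂ) * (τ : ℂ) + (D : ℂ))
    simp [abs_mul, abs_of_pos hτ] at this
    nlinarith

lemma orbit_im_bound (m h : ℕ) (hm : 0 < m) (E : Set ℕ) (hE : ∀ k ∈ E, k ∣ m)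
    (τ : UpperHalfPlane) (f : UpperHalfPlane → UpperHalfPlane) (hf : f ∈ GammaSet m h E) :
    (f τ).im ≤ m * h ^ 2 * τ.im / (min 1 τ.im) ^ 2 := by
  obtain ⟨k, w, x, y, z, hk, hdet, hf⟩ := hf
  have h0 := gamma_im_le m h hm E hE τ f k w x y z hk hdet hf
  have hmin : 0 < min 1 τ.im := lt_min one_pos τ.im_pos
  rw [le_div_iff₀ (by positivity)]
  refine le_trans ?_ h0
  have hp := (f τ).im_pos
  have hl := norm_lower τ (m * h ^ 2 * y) (k * h * z) (by
    intro hz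
    have := hf τ
    rw [hz, div_zero] at this
    exact (f τ).ne_zero this)
  gcongr

/-- Finiteness of the part of an orbit in a bounded strip. -/
lemma finite_orbit (m h : ℕ) (hm : 0 < m) (E : Set ℕ) (hE : ∀ k ∈ E, k ∣ m)
    (τ : UpperHalfPlane) (c R : ℝ) (hc : 0 < c) :
    {σ : UpperHalfPlane | (∃ f ∈ GammaSet m h E, f τ = σ) ∧ c ≤ σ.im ∧ σ.im ≤ R ∧
      |σ.re| ≤ R}.Finite := by
  have hτ := τ.im_pos
  set M : ℝ := Real.sqrt ((m : ℝ) * h ^ 2 * τ.im / c) with hM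
  have hfin := (finite_pairs τ ((R + R) * M)).prod (finite_pairs τ M)
  have hfin2 := hfin.image (fun q : (ℤ × ℤ) × (ℤ × ℤ) =>
    ((q.1.1 : ℂ) * (τ : ℂ) + (q.1.2 : ℂ)) / ((q.2.1 : ℂ) * (τ : ℂ) + (q.2.2 : ℂ)))
  refine (hfin2.preimage (f := fun σ : UpperHalfPlane => (σ : ℂ))
    (fun a _ b _ hab => UpperHalfPlane.ext hab)).subset ?_
  rintro σ ⟨⟨f, ⟨k, w, x, y, z, hk, hdet, hf⟩, rfl⟩, h1, h2, h3⟩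
  have him := gamma_im_le m h hm E hE τ f k w x y z hk hdet hf
  have heq := moebius_eq hf τ
  have hCD : ‖((m * h ^ 2 * y : ℤ) : ℂ) * (τ : ℂ) + ((k * h * z : ℤ) : ℂ)‖ ≤ M := by
    refine Real.le_sqrt_of_sq_le ?_
    rw [le_div_iff₀ hc]
    have a1 := mul_le_mul_of_nonneg_right h1
      (sq_nonneg ‖((m * h ^ 2 * y : ℤ) : ℂ) * (τ : ℂ) + ((k * h * z : ℤ) : ℂ)‖)
    linarith
  refine ⟨((k * h * w, x), (m * h ^ 2 * y, k * h * z)), ⟨?_, hCD⟩, (hf τ).symm⟩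
  simp only [Set.mem_ofPred_eq]
  rw [← heq, norm_mul]
  have hn : ‖(f τ : ℂ)‖ ≤ R + R := by
    refine (Complex.norm_le_abs_re_add_abs_im _).trans ?_
    rw [UpperHalfPlane.coe_re, UpperHalfPlane.coe_im, abs_of_pos (f τ).im_pos]
    linarith
  exact mul_le_mul hn hCD (norm_nonneg _) ((norm_nonneg _).trans hn)

lemma one_mem (m h : ℕ) (hm : 0 < m) (hh : 0 < h) (E : Set ℕ)
    (hid : id ∈ GammaSet m h E) : 1 ∈ E := by
  obtain ⟨k, w, x, y, z, hk, hdet, hf⟩ := hid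
  have hy : y = 0 := by
    have key : ∀ A B C D : ℤ, IsMoebiusOf A B C D id → (C : ℝ) = 0 := by
      intro A B C D hf
      have e2 := congrArg Complex.re (moebius_eq hf UpperHalfPlane.I)
      let J : UpperHalfPlane := ⟨2 * Complex.I, by simp⟩
      have hJ : (J : ℂ) = 2 * Complex.I := rfl
      have e3 := moebius_eq hf J
      simp only [id, hJ] at e3
      have e4 := congrArg Complex.re e3
      simp at e2 e4
      linarith
    have := key _ _ _ _ hf
    push_cast at this
    have hm' : (m : ℝ) ≠ 0 := by positivity
    have hh' : (h : ℝ) ≠ 0 := by positivity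
    simpa [hm', hh', hm.ne', hh.ne'] using this
  subst hy
  have h1 : (k : ℤ) ∣ 1 := ⟨w * z, by linarith⟩
  have : k = 1 := by
    have := Int.natCast_dvd_natCast.1 (by simpa using h1 : (k : ℤ) ∣ ((1 : ℕ) : ℤ))
    exact Nat.dvd_one.1 this
  exact this ▸ hk

/-- Translating into the strip. -/
lemma exists_translate (m h : ℕ) (hh : 0 < h) (E : Set ℕ) (h1 : 1 ∈ E) (τ : UpperHalfPlane) :
    ∃ K ∈ GammaSet m h E, (K τ).im = τ.im ∧ -(1 / (2 * (h : ℝ))) < (K τ).re ∧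
      (K τ).re ≤ 1 / (2 * (h : ℝ)) := by
  have hh' : (0 : ℝ) < h := by exact_mod_cast hh
  obtain ⟨n, hn, -⟩ := existsUnique_add_zsmul_mem_Ioc (one_div_pos.2 hh') τ.re
    (-(1 / (2 * (h : ℝ))))
  refine ⟨fun σ => ((n : ℝ) / h) +ᵥ σ, ⟨1, 1, n, 0, 1, h1, by simp, ?_⟩, ?_, ?_, ?_⟩
  · intro σ
    have : (h : ℂ) ≠ 0 := by exact_mod_cast hh.ne'
    rw [UpperHalfPlane.coe_vadd]
    push_cast
    field_simp
    ring
  · simp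
  · have := hn.1
    rw [zsmul_eq_mul, mul_one_div] at this
    rw [UpperHalfPlane.vadd_re]
    linarith
  · have := hn.2
    have e : -(1 / (2 * (h : ℝ))) + 1 / h = 1 / (2 * (h : ℝ)) := by
      field_simp
      norm_num
    rw [zsmul_eq_mul, mul_one_div, e] at this
    rw [UpperHalfPlane.vadd_re]
    linarith

/-- Existence and uniqueness of the fundamental-domain representative: if
`Γ₀(mh∣h)+E` is a group under composition, then every `Γ`-orbit in `ℍ`
contains exactly one point satisfying the fundamental-domain conditions for
`Γ` with width `1/h`. -/
theorem fundamental_domain_exists_unique (m h : ℕ) (hm : 0 < m) (hh : 0 < h)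
    (E : Set ℕ) (hE : ∀ k ∈ E, k ∣ m ∧ Nat.gcd k (m / k) = 1)
    (hgrp : IsGroupUnderComp (GammaSet m h E)) (τ : UpperHalfPlane) :
    ∃! τ' : UpperHalfPlane,
      (∃ f ∈ GammaSet m h E, f τ = τ') ∧ FDConds (GammaSet m h E) h τ' := by
  obtain ⟨hid, hcomp, hinv⟩ := hgrp
  have h1E := one_mem m h hm hh E hid
  have htr := exists_translate m h hh E h1E
  set Γ := GammaSet m h E with hΓ
  -- points related by the group with condition (1) have the same height
  have himeq : ∀ σ : UpperHalfPlane, (∀ K ∈ Γ, (K σ).im ≤ σ.im) → ∀ K ∈ Γ,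
      (∀ K' ∈ Γ, (K' (K σ)).im ≤ (K σ).im) → (K σ).im = σ.im := by
    intro σ hσ K hK hKσ
    refine le_antisymm (hσ K hK) ?_
    obtain ⟨g, hg, -, hgK⟩ := hinv K hK
    have := hKσ g hg
    have e : g (K σ) = σ := congrFun hgK σ
    rwa [e] at this
  have hh' : (0 : ℝ) < 1 / (2 * (h : ℝ)) := by positivity
  -- orbit points in the strip above height `τ.im`
  let S : Set UpperHalfPlane := {σ | (∃ f ∈ Γ, f τ = σ) ∧ τ.im ≤ σ.im ∧
    -(1 / (2 * (h : ℝ))) < σ.re ∧ σ.re ≤ 1 / (2 * (h : ℝ))}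
  have hbound : ∃ R : ℝ, ∀ σ ∈ S, σ.im ≤ R ∧ |σ.re| ≤ R := by
    refine ⟨max (m * h ^ 2 * τ.im / (min 1 τ.im) ^ 2) (1 / (2 * (h : ℝ))), ?_⟩
    rintro _ ⟨⟨f, hf, rfl⟩, -, b, c⟩
    exact ⟨(orbit_im_bound m h hm E (fun k hk => (hE k hk).1) τ f hf).trans (le_max_left _ _),
      (abs_le.2 ⟨b.le, c⟩).trans (le_max_right _ _)⟩
  obtain ⟨R, hR⟩ := hbound
  have hSfin : S.Finite := by
    refine (finite_orbit m h hm E (fun k hk => (hE k hk).1) τ τ.im R τ.im_pos).subset ?_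
    rintro σ hσ
    exact ⟨hσ.1, hσ.2.1, hR σ hσ⟩
  have hSne : S.Nonempty := by
    obtain ⟨K, hK, a, b, c⟩ := htr τ
    exact ⟨K τ, ⟨K, hK, rfl⟩, a.ge, b, c⟩
  obtain ⟨σ, hσS, hσmax⟩ := hSfin.exists_maximalFor
    (fun σ : UpperHalfPlane => toLex (σ.im, σ.re)) S hSne
  have hmax : ∀ ρ ∈ S, ρ.im < σ.im ∨ ρ.im = σ.im ∧ ρ.re ≤ σ.re := by
    intro ρ hρ
    have : toLex (ρ.im, ρ.re) ≤ toLex (σ.im, σ.re) := by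
      rcases le_total (toLex (ρ.im, ρ.re)) (toLex (σ.im, σ.re)) with h | h
      · exact h
      · exact hσmax hρ h
    simpa [Prod.Lex.toLex_le_toLex] using this
  obtain ⟨⟨f, hf, hfσ⟩, hσim, hσl, hσr⟩ := hσS
  have hc1 : ∀ K ∈ Γ, (K σ).im ≤ σ.im := by
    intro K hK
    by_contra! hlt
    obtain ⟨T, hT, a, b, c⟩ := htr (K σ)
    have := hmax (T (K σ)) ⟨⟨T ∘ (K ∘ f), hcomp _ hT _ (hcomp _ hK _ hf), by simp [hfσ]⟩,
      by rw [a]; linarith, b, c⟩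
    rw [a] at this
    rcases this with h | h <;> linarith [h]
  refine ⟨σ, ⟨⟨f, hf, hfσ⟩, hc1, ⟨hσl, hσr⟩, ?_⟩, ?_⟩
  · rintro K hK ⟨ha, hb, hc⟩
    have e := himeq σ hc1 K hK ha
    rcases hmax (K σ) ⟨⟨K ∘ f, hcomp _ hK _ hf, by simp [hfσ]⟩, by rw [e]; exact hσim, hb, hc⟩
      with h | h
    · linarith
    · exact h.2
  · rintro ρ ⟨⟨g, hg, hgρ⟩, hρ1, hρ2, hρ3⟩
    obtain ⟨fi, hfi, -, hfi2⟩ := hinv f hf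
    obtain ⟨gi, hgi, -, hgi2⟩ := hinv g hg
    have e1 : fi σ = τ := by rw [← hfσ]; exact congrFun hfi2 τ
    have e2 : gi ρ = τ := by rw [← hgρ]; exact congrFun hgi2 τ
    have k1 : (g ∘ fi) σ = ρ := by simp [e1, hgρ]
    have k2 : (f ∘ gi) ρ = σ := by simp [e2, hfσ]
    have m1 := hcomp _ hg _ hfi
    have m2 := hcomp _ hf _ hgi
    have him := himeq σ hc1 _ m1 (by rw [k1]; exact hρ1)
    rw [k1] at him
    have r1 : σ.re ≤ ρ.re := by
      have := hρ3 _ m2 (by rw [k2]; exact ⟨hc1, hσl, hσr⟩)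
      rwa [k2] at this
    have r2 : ρ.re ≤ σ.re := by
      rcases hmax ρ ⟨⟨g, hg, hgρ⟩, by rw [him]; exact hσim, hρ2⟩ with h | h
      · linarith
      · exact h.2
    exact UpperHalfPlane.ext (Complex.ext (le_antisymm r2 r1) him)
end

section
/- Let m, h be positive integers and let E be a set of exact divisors of m. Then the following are equivalent: (i) every rational number r can be written as r = (k·z)/(m·h·y) for some k ∈ E and integers y, z with y > 0 and gcd(k·z, (m/k)·y) = 1; (ii) m is squarefree and E = Ex(m), the set of all exact divisors of m. (Equivalently: the set of points π(K) = K⁻¹(∞) for K ranging over Γ₀(mh∣h)+E, together with ∞, equals all of ℚ ∪ {∞} if and only if m is squarefree and E = Ex(m).) -/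
theorem single_cusp_aux (m h k D : ℕ) (hm : 0 < m) (hh : 0 < h) (hD : 0 < D)
    (hk : k ∣ m) (y z : ℤ) (hy : 0 < y)
    (hg : Int.gcd ((k : ℤ) * z) (((m / k : ℕ) : ℤ) * y) = 1)
    (hr : (1 : ℚ) / (h * D) = ((k : ℚ) * z) / ((m : ℚ) * h * y)) :
    (m / k) ∣ D ∧ Nat.Coprime k D := by
  obtain ⟨l, rfl⟩ := hk
  have hk0 : 0 < k := Nat.pos_of_mul_pos_right hm
  have hl0 : 0 < l := Nat.pos_of_mul_pos_left hm
  rw [Nat.mul_div_cancel_left _ hk0] at hg ⊢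
  have e : (l : ℤ) * y = z * D := by
    have : (l : ℚ) * y = z * D := by
      have h1 : (k : ℚ) ≠ 0 := by positivity
      have h2 : (l : ℚ) ≠ 0 := by positivity
      have h3 : (h : ℚ) ≠ 0 := by positivity
      have h4 : (D : ℚ) ≠ 0 := by positivity
      have h5 : (y : ℚ) ≠ 0 := by exact_mod_cast hy.ne'
      push_cast at hr
      field_simp at hr
      linarith
    exact_mod_cast this
  have hc : IsCoprime ((k : ℤ) * z) (l * y) := Int.isCoprime_iff_gcd_eq_one.mpr hg
  rw [e] at hc
  have hzu : IsUnit z := hc.of_mul_left_right.of_mul_right_left.isUnit_of_dvd' dvd_rfl dvd_rfl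
  refine ⟨?_, ?_⟩
  · have : (l : ℤ) ∣ z * D := ⟨y, e.symm⟩
    exact_mod_cast (hzu.dvd_mul_left).mp this
  · exact Nat.isCoprime_iff_coprime.mp hc.of_mul_left_left.of_mul_right_right

/-- Single cusp criterion: for positive integers `m, h` and a set `E` of exact
divisors of `m`, every rational number is of the form `(k·z)/(m·h·y)` with
`k ∈ E`, `y > 0` and `gcd(k·z, (m/k)·y) = 1` if and only if `m` is squarefree
and `E` is the set of all exact divisors of `m`. -/
theorem single_cusp_criterion (m h : ℕ) (hm : 0 < m) (hh : 0 < h) (E : Set ℕ)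
    (hE : ∀ k ∈ E, k ∣ m ∧ Nat.gcd k (m / k) = 1) :
    (∀ r : ℚ, ∃ k ∈ E, ∃ y z : ℤ, 0 < y ∧
        Int.gcd ((k : ℤ) * z) (((m / k : ℕ) : ℤ) * y) = 1 ∧
        r = ((k : ℚ) * z) / ((m : ℚ) * h * y)) ↔
      (Squarefree m ∧ E = {k : ℕ | k ∣ m ∧ Nat.gcd k (m / k) = 1}) := by
  constructor
  · intro H
    have key : ∀ D : ℕ, 0 < D → ∃ k ∈ E, (m / k) ∣ D ∧ Nat.Coprime k D := by
      intro D hD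
      obtain ⟨k, hkE, y, z, hy, hg, hr⟩ := H (1 / (h * D))
      exact ⟨k, hkE, single_cusp_aux m h k D hm hh hD (hE k hkE).1 y z hy hg hr⟩
    constructor
    · rw [Nat.squarefree_iff_prime_squarefree]
      intro p hp hpm
      obtain ⟨k, hkE, h1, h2⟩ := key p hp.pos
      have h3 : p * p ∣ k * (m / k) := by rwa [Nat.mul_div_cancel' (hE k hkE).1]
      have h4 : p * p ∣ m / k :=
        (Nat.Coprime.mul_left h2.symm h2.symm).dvd_of_dvd_mul_left h3
      have h5 := Nat.le_of_dvd hp.pos (h4.trans h1)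
      nlinarith [hp.two_le]
    · ext k
      refine ⟨hE k, ?_⟩
      rintro ⟨⟨l, rfl⟩, hc⟩
      have hk0 : 0 < k := Nat.pos_of_mul_pos_right hm
      have hl0 : 0 < l := Nat.pos_of_mul_pos_left hm
      obtain ⟨k', hkE, h1, h2⟩ := key l hl0
      have h3 : k' * (k * l / k') = k * l := Nat.mul_div_cancel' (hE k' hkE).1
      have h4 : l ∣ k * l / k' := h2.symm.dvd_of_dvd_mul_left (by rw [h3]; exact Dvd.intro_left k rfl)
      rw [Nat.dvd_antisymm h1 h4] at h3
      rwa [← Nat.eq_of_mul_eq_mul_right hl0 h3]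
  · rintro ⟨hs, rfl⟩ r
    set q : ℚ := r * h with hq
    have hh' : (h : ℚ) ≠ 0 := by positivity
    obtain ⟨k, hkm⟩ := Nat.gcd_dvd_left m q.den
    obtain ⟨y, hyD⟩ := Nat.gcd_dvd_right m q.den
    set l := Nat.gcd m q.den with hl
    have hl0 : 0 < l := Nat.gcd_pos_of_pos_left _ hm
    have hk0 : 0 < k := Nat.pos_of_ne_zero (by rintro rfl; omega)
    have hy0 : 0 < y := Nat.pos_of_ne_zero (by rintro rfl; exact q.den_nz (by simpa using hyD))
    have hdiv : m / k = l := by rw [hkm, Nat.mul_div_cancel _ hk0]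
    have hcop : Nat.Coprime l k := Nat.coprime_of_squarefree_mul (hkm ▸ hs)
    have hkD : Nat.Coprime k q.den := by
      have h1 : Nat.gcd k q.den ∣ l :=
        Nat.dvd_gcd ((Nat.gcd_dvd_left _ _).trans ⟨l, by rw [hkm, mul_comm]⟩) (Nat.gcd_dvd_right _ _)
      exact Nat.eq_one_of_dvd_coprimes hcop h1 (Nat.gcd_dvd_left _ _)
    refine ⟨k, ⟨⟨l, by rw [hkm, mul_comm]⟩, by rw [hdiv]; exact hcop.symm⟩, y, q.num,
      by exact_mod_cast hy0, ?_, ?_⟩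
    · rw [hdiv, ← Int.isCoprime_iff_gcd_eq_one]
      have : (l : ℤ) * y = (q.den : ℤ) := by exact_mod_cast hyD.symm
      rw [this]
      refine IsCoprime.mul_left (Nat.isCoprime_iff_coprime.mpr hkD) ?_
      rw [Int.isCoprime_iff_gcd_eq_one]
      exact q.reduced
    · have h1 : r = q / h := by rw [hq]; field_simp
      have h2 : q = q.num / (l * y) := by
        have : (q.den : ℚ) = l * y := by exact_mod_cast hyD
        rw [← this, Rat.num_div_den]
      have h3 : (m : ℚ) = l * k := by exact_mod_cast hkm
      have h4 : (k : ℚ) ≠ 0 := by positivity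
      have h5 : (l : ℚ) ≠ 0 := by positivity
      have h6 : (y : ℚ) ≠ 0 := by positivity
      rw [h1, h3]
      generalize q.num = n at *
      rw [h2]
      push_cast
      field_simp
end

section
/- Let m, h, n be positive integers with gcd(n, h) = 1, and let a, b, d ∈ ℤ with a·d = n, a > 0 and 0 ≤ b < d; set H = [[a, b],[0, d]]. Let ℓ be an exact divisor of m/gcd(a, m) and s, t, u, v ∈ ℤ with u > 0 and ℓ·s·v − (m/(gcd(a,m)·ℓ))·t·u = 1, and set G = [[ℓ·h·s, t],[(m/gcd(a,m))·h²·u, ℓ·h·v]]. Let k be an exact divisor of m and w, x, y, z ∈ ℤ with y > 0 and k·w·z − (m/k)·x·y = 1, and set K = [[k·h·w, x],[m·h²·y, k·h·z]]. Assume π(K) = π(G·H), i.e., k·z·(a/gcd(a,m))·u = ℓ·y·(d·v + b·h·u·(m/(ℓ·gcd(a,m)))). Then N₁ := (a·u)/(gcd(a,m)·y) and N₂ := k/ℓ are positive integers, and there exists an integer r such that, as Möbius transformations, G∘H∘K⁻¹ is the map τ ↦ (n/(N₁²·N₂))·τ + r/(h·N₁·N₂). In particular, either N₁²·N₂ = 1,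 so that G∘H∘K⁻¹ is τ ↦ n·τ + r/h, or n/(N₁²·N₂) ≤ n/2. -/
open Matrix

theorem ghk_core (g A M L Q ℓ k h n a b d s t u v w x y z m : ℤ) (hℓ : 0 < ℓ) (hk0 : 0 < k)
    (hA : 0 < A)
    (had : a * d = n) (hag : a = g * A) (hmg : m = g * M) (hM : M = ℓ * L) (hQ : m = k * Q)
    (hAM : IsCoprime A M) (hu : 0 < u) (hdetG : ℓ * s * v - L * t * u = 1) (hy : 0 < y)
    (hdetK : k * w * z - Q * x * y = 1)
    (hpi : k * z * A * u = ℓ * y * (d * v + b * h * u * L)) :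
    ∃ N₁ N₂ : ℤ, 0 < N₁ ∧ 0 < N₂ ∧ y * N₁ = A * u ∧ ℓ * N₂ = k ∧
      N₂ * z * N₁ = d * v + b * h * u * L ∧ Q * N₂ = L * g := by
  have h1 : IsCoprime ℓ A := by
    rw [hM] at hAM
    exact (IsCoprime.of_mul_right_left hAM).symm
  have h2 : IsCoprime ℓ u := ⟨s * v, -(L * t), by linear_combination hdetG⟩
  have h3 : ℓ ∣ k * z := by
    have : ℓ ∣ (k * z * A) * u := ⟨y * (d * v + b * h * u * L), by rw [hpi]; ring⟩
    exact h1.dvd_of_dvd_mul_right (h2.dvd_of_dvd_mul_right this)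
  have h4 : ℓ ∣ k * Q := ⟨L * g, by rw [← hQ, hmg, hM]; ring⟩
  have h5 : ℓ ∣ k := by
    have e : k = (k * z) * (k * w) - (k * Q) * (x * y) := by linear_combination (-k) * hdetK
    rw [e]
    exact dvd_sub (h3.mul_right _) (h4.mul_right _)
  obtain ⟨N₂, rfl⟩ := h5
  have hN₂ : 0 < N₂ := pos_of_mul_pos_right hk0 hℓ.le
  have hpi' : (N₂ * z) * (A * u) = y * (d * v + b * h * u * L) := by
    apply mul_left_cancel₀ hℓ.ne'
    linear_combination hpi
  have h6 : IsCoprime y (N₂ * z) := ⟨-(Q * x), ℓ * w, by linear_combination hdetK⟩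
  obtain ⟨N₁, hN₁⟩ := h6.dvd_of_dvd_mul_left ⟨_, hpi'⟩
  refine ⟨N₁, N₂, ?_, hN₂, hN₁.symm, rfl, ?_, ?_⟩
  · have : 0 < y * N₁ := hN₁ ▸ mul_pos hA hu
    exact pos_of_mul_pos_right this hy.le
  · apply mul_left_cancel₀ hy.ne'
    rw [← hpi', hN₁]; ring
  · apply mul_left_cancel₀ hℓ.ne'
    have : g * (ℓ * L) = ℓ * N₂ * Q := by rw [← hM, ← hmg, hQ]
    linear_combination -this

/-- Lemma on `G·H·K⁻¹`: let `gcd(n,h) = 1`, `H = [[a,b],[0,d]]` a Hecke matrix of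
level `n`, `G` a canonical coset representative for the replicate group
`Γ₀((m/(a,m))h ∣ h)+` and `K` one for `Γ₀(mh∣h)+` with `y > 0` and
`π(K) = π(G·H)`.  Then `N₁ = au/((a,m)y)` and `N₂ = k/ℓ` are positive integers,
and for some integer `r` the product `G·H·K⁻¹` is, up to a nonzero rational
scalar, the matrix of `τ ↦ (n/(N₁²N₂))·τ + r/(hN₁N₂)`.  In particular either
`N₁²N₂ = 1` or `n/(N₁²N₂) ≤ n/2`. -/
theorem GHK_inverse_expression (m h n : ℕ) (hm : 0 < m) (hh : 0 < h) (hn : 0 < n)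
    (hnh : Nat.gcd n h = 1)
    (a b d : ℤ) (ha : 0 < a) (had : a * d = n) (hb0 : 0 ≤ b) (hbd : b < d)
    (ℓ : ℕ) (hl : ℓ ∣ m / Int.gcd a (m : ℤ) ∧
      Nat.gcd ℓ ((m / Int.gcd a (m : ℤ)) / ℓ) = 1)
    (s t u v : ℤ) (hu : 0 < u)
    (hdetG : (ℓ : ℤ) * s * v -
      (((m / Int.gcd a (m : ℤ)) / ℓ : ℕ) : ℤ) * t * u = 1)
    (k : ℕ) (hk : k ∣ m ∧ Nat.gcd k (m / k) = 1)
    (w x y z : ℤ) (hy : 0 < y)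
    (hdetK : (k : ℤ) * w * z - ((m / k : ℕ) : ℤ) * x * y = 1)
    (hpi : (k : ℤ) * z * (a / (Int.gcd a (m : ℤ) : ℤ)) * u =
      (ℓ : ℤ) * y * (d * v + b * (h : ℤ) * u * ((m / (ℓ * Int.gcd a (m : ℤ)) : ℕ) : ℤ))) :
    ∃ N₁ N₂ : ℤ, 0 < N₁ ∧ 0 < N₂ ∧
      (Int.gcd a (m : ℤ) : ℤ) * y * N₁ = a * u ∧ (ℓ : ℤ) * N₂ = (k : ℤ) ∧
      (∃ (r : ℤ) (c : ℚ), c ≠ 0 ∧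
        !![(ℓ : ℚ) * h * s, (t : ℚ);
            ((m / Int.gcd a (m : ℤ) : ℕ) : ℚ) * h ^ 2 * u, (ℓ : ℚ) * h * v] *
          !![(a : ℚ), (b : ℚ); 0, (d : ℚ)] *
          (!![(k : ℚ) * h * w, (x : ℚ); (m : ℚ) * h ^ 2 * y, (k : ℚ) * h * z])⁻¹ =
        c • !![(n : ℚ) / ((N₁ : ℚ) ^ 2 * (N₂ : ℚ)),
                (r : ℚ) / ((h : ℚ) * N₁ * N₂); 0, 1]) ∧
      (N₁ ^ 2 * N₂ = 1 ∨ (n : ℚ) / ((N₁ : ℚ) ^ 2 * (N₂ : ℚ)) ≤ (n : ℚ) / 2) := by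
  have hgN : 0 < Int.gcd a (m : ℤ) := Int.gcd_pos_of_ne_zero_left _ ha.ne'
  have hdvd : Int.gcd a (m : ℤ) ∣ m := by
    exact_mod_cast Int.gcd_dvd_right a (m : ℤ)
  have hag : (Int.gcd a (m : ℤ) : ℤ) ∣ a := Int.gcd_dvd_left a (m : ℤ)
  have hcop : IsCoprime (a / (Int.gcd a (m : ℤ) : ℤ)) ((m : ℤ) / (Int.gcd a (m : ℤ) : ℤ)) := by
    rw [Int.isCoprime_iff_gcd_eq_one]
    exact Int.gcd_ediv_gcd_ediv_gcd hgN
  rw [mul_comm ℓ, ← Nat.div_div_eq_div_mul] at hpi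
  generalize Int.gcd a (m : ℤ) = g at *
  obtain ⟨A, rfl⟩ := hag
  obtain ⟨M, rfl⟩ := hdvd
  have hgZ : (0 : ℤ) < g := by exact_mod_cast hgN
  rw [Nat.mul_div_cancel_left _ hgN] at *
  obtain ⟨⟨L, rfl⟩, -⟩ := hl
  obtain ⟨⟨Q, hQ⟩, -⟩ := hk
  have hℓ : 0 < ℓ := by
    rcases Nat.eq_zero_or_pos ℓ with rfl | h0
    · simp at hm
    · exact h0
  have hk0 : 0 < k := by
    rcases Nat.eq_zero_or_pos k with rfl | h0
    · rw [hQ] at hm; simp at hm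
    · exact h0
  rw [Nat.mul_div_cancel_left _ hℓ] at *
  rw [hQ, Nat.mul_div_cancel_left _ hk0] at hdetK
  have hA : 0 < A := pos_of_mul_pos_right ha hgZ.le
  rw [Int.mul_ediv_cancel_left _ hgZ.ne'] at *
  have hMM : (((g * (ℓ * L) : ℕ) : ℤ)) / (g : ℤ) = ℓ * L := by
    push_cast
    rw [Int.mul_ediv_cancel_left _ hgZ.ne']
  rw [hMM] at hcop
  have hQZ : (g : ℤ) * (ℓ * L) = k * Q := by exact_mod_cast hQ
  obtain ⟨N₁, N₂, p1, p2, e1, e2, e3, e4⟩ :=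
    ghk_core g A (ℓ * L) L Q ℓ k h n (g * A) b d s t u v w x y z (g * (ℓ * L))
      (by exact_mod_cast hℓ) (by exact_mod_cast hk0) hA had rfl rfl rfl hQZ hcop hu hdetG hy
      hdetK hpi
  refine ⟨N₁, N₂, p1, p2, by linear_combination (g : ℤ) * e1, e2, ?_, ?_⟩
  · refine ⟨-x * s * (g * A) + N₂ * w * (ℓ * h * s * b + t * d), N₁, by exact_mod_cast p1.ne', ?_⟩
    have q1 : (N₁ : ℚ) ≠ 0 := by exact_mod_cast p1.ne'
    have q2 : (N₂ : ℚ) ≠ 0 := by exact_mod_cast p2.ne'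
    have qh : (h : ℚ) ≠ 0 := by exact_mod_cast hh.ne'
    have qk : (k : ℚ) ≠ 0 := by exact_mod_cast hk0.ne'
    have ql : (ℓ : ℚ) ≠ 0 := by exact_mod_cast hℓ.ne'
    have f1 : (y : ℚ) * N₁ = A * u := by exact_mod_cast e1
    have f2 : (ℓ : ℚ) * N₂ = k := by exact_mod_cast e2
    have f3 : (N₂ : ℚ) * z * N₁ = d * v + b * h * u * L := by exact_mod_cast e3
    have f4 : (Q : ℚ) * N₂ = L * g := by exact_mod_cast e4
    have fG : (ℓ : ℚ) * s * v - L * t * u = 1 := by exact_mod_cast hdetG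
    have fK : (k : ℚ) * w * z - Q * x * y = 1 := by exact_mod_cast hdetK
    have fn : (g : ℚ) * A * d = n := by exact_mod_cast had
    have fQ : (g : ℚ) * (ℓ * L) = k * Q := by exact_mod_cast hQZ
    have fpi : (k : ℚ) * z * A * u = ℓ * y * (d * v + b * h * u * L) := by exact_mod_cast hpi
    have hdet : (!![(k : ℚ) * h * w, (x : ℚ);
        ((g * (ℓ * L) : ℕ) : ℚ) * h ^ 2 * y, (k : ℚ) * h * z]).det = k * h ^ 2 := by
      rw [Matrix.det_fin_two_of]
      push_cast
      rw [fQ]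
      linear_combination (k : ℚ) * h ^ 2 * fK
    rw [Matrix.inv_def, hdet, Ring.inverse_eq_inv', Matrix.adjugate_fin_two_of]
    have hK0 : (k : ℚ) * h ^ 2 ≠ 0 := mul_ne_zero qk (pow_ne_zero 2 qh)
    have g11 : (N₁ : ℚ) * N₂ * (ℓ * s * (g * A) * z - Q * y * (ℓ * h * s * b + t * d)) = n := by
      linear_combination (ℓ : ℚ) * s * g * A * f3 - N₂ * Q * (ℓ * h * s * b + t * d) * f1
        - A * u * (ℓ * h * s * b + t * d) * f4 + (g : ℚ) * A * d * fG + fn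
    ext i j
    fin_cases i <;> fin_cases j
    · simp [Matrix.mul_apply, Fin.sum_univ_two]
      rw [← g11]
      field_simp
      linear_combination (-(y : ℚ) * (t * d + ℓ * h * s * b)) * fQ
    · simp [Matrix.mul_apply, Fin.sum_univ_two]
      rw [← f2]
      field_simp
    · simp [Matrix.mul_apply, Fin.sum_univ_two]
      field_simp
      linear_combination (ℓ : ℚ) * L * h * g * fpi
    · simp [Matrix.mul_apply, Fin.sum_univ_two]
      field_simp
      linear_combination (ℓ : ℚ) * L * g * x * f1 - x * y * N₁ * fQ - ℓ * k * w * f3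
        + k * w * z * N₁ * f2 + k * N₁ * fK
  · rcases Int.lt_or_le 1 (N₁ ^ 2 * N₂) with hlt | hle
    · right
      have : (2 : ℚ) ≤ (N₁ : ℚ) ^ 2 * N₂ := by exact_mod_cast hlt
      exact div_le_div_of_nonneg_left (by positivity) (by norm_num) this
    · left
      have : 0 < N₁ ^ 2 * N₂ := by positivity
      omega
end

section
/- Let f = q^{−1} + Σ_{k≥0} a_k q^k and g = q^{−1} + Σ_{k≥0} b_k q^k be normalized formal Laurent series over ℂ, let d and n be positive integers with d ∣ n, and let c ∈ ℂ. Assume f^d = g(q^d) + c (coefficientwise). Then the Faber polynomials satisfy F_{n,f}(X) = F_{n/d, g}(X^d − c). Consequently, the roots of F_{n,f} (with multiplicity) are exactly the d-th roots of the numbers Y + c as Y ranges over the roots of F_{n/d, g} (with multiplicity). -/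
/-- `f = q⁻¹ + Σ_{k ≥ 0} a_k qᵏ` is a normalized formal Laurent series. -/
def NormalizedLS (f : LaurentSeries ℂ) : Prop :=
  f.coeff (-1) = 1 ∧ ∀ j : ℤ, j < -1 → f.coeff j = 0

/-- `F` is the `n`-th Faber polynomial of `f`: `F(f) − q^{−n}` has zero
coefficient in every degree `≤ 0`. -/
def IsFaberPoly (f : LaurentSeries ℂ) (n : ℕ) (F : Polynomial ℂ) : Prop :=
  ∀ j : ℤ, j ≤ 0 →
    (Polynomial.aeval f F - HahnSeries.single (-(n : ℤ)) (1 : ℂ)).coeff j = 0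

theorem aux_aeval (f : LaurentSeries ℂ) (P : Polynomial ℂ) :
    Polynomial.aeval f P = P.eval₂ (HahnSeries.C : ℂ →+* LaurentSeries ℂ) f := by
  rw [Polynomial.aeval_def]
  congr 1
  ext1 x
  rw [HahnSeries.algebraMap_apply']
  simp

theorem aux_coeff_pow (f : LaurentSeries ℂ) (hf : NormalizedLS f) (k : ℕ) :
    (f ^ k).coeff (-(k : ℤ)) = 1 ∧ ∀ j : ℤ, j < -(k : ℤ) → (f ^ k).coeff j = 0 := by
  obtain ⟨h1, h2⟩ := hf
  have hf0 : f ≠ 0 := by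
    rintro rfl
    simp at h1
  have ho : f.order = -1 := by
    apply le_antisymm
    · exact HahnSeries.order_le_of_coeff_ne_zero (by rw [h1]; exact one_ne_zero)
    · by_contra! hlt
      exact hf0 (HahnSeries.coeff_order_eq_zero.1 (h2 _ hlt))
  have hok : (f ^ k).order = -(k : ℤ) := by
    rw [HahnSeries.order_pow, ho]; simp
  have hl : ∀ m : ℕ, (f ^ m).leadingCoeff = 1 := by
    intro m
    induction m with
    | zero => simp
    | succ m ih =>
      rw [pow_succ, HahnSeries.leadingCoeff_mul, ih, HahnSeries.leadingCoeff_eq, ho, h1, one_mul]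
  refine ⟨?_, fun j hj => HahnSeries.coeff_eq_zero_of_lt_order (by rw [hok]; exact hj)⟩
  rw [← hok, ← HahnSeries.leadingCoeff_eq, hl]

theorem aux_coeff_aeval (f : LaurentSeries ℂ) (P : Polynomial ℂ) (j : ℤ) :
    (Polynomial.aeval f P).coeff j
      = ∑ k ∈ Finset.range (P.natDegree + 1), P.coeff k * (f ^ k).coeff j := by
  rw [aux_aeval, Polynomial.eval₂_eq_sum_range, HahnSeries.coeff_sum]
  refine Finset.sum_congr rfl fun k _ => ?_
  rw [HahnSeries.C_mul_eq_smul]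
  rfl

theorem aux_unique (f : LaurentSeries ℂ) (hf : NormalizedLS f) (P : Polynomial ℂ)
    (h : ∀ j : ℤ, j ≤ 0 → (Polynomial.aeval f P).coeff j = 0) : P = 0 := by
  have h1 := h (-(P.natDegree : ℤ)) (by simp)
  rw [aux_coeff_aeval, Finset.sum_range_succ, Finset.sum_eq_zero, zero_add,
    (aux_coeff_pow f hf _).1, mul_one] at h1
  · exact Polynomial.leadingCoeff_eq_zero.1 h1
  · intro k hk
    rw [(aux_coeff_pow f hf k).2 _ (by have := Finset.mem_range.1 hk; omega), mul_zero]

theorem aux_roots (P : Polynomial ℂ) (d : ℕ) (hd : 0 < d) (c : ℂ) :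
    (P.comp (Polynomial.X ^ d - Polynomial.C c)).roots =
        (P.roots.map (· + c)).bind
          (fun w => (Polynomial.X ^ d - Polynomial.C w).roots) := by
  by_cases hP : P = 0
  · subst hP; simp
  conv_lhs => rw [(IsAlgClosed.splits P).eq_prod_roots]
  rw [Polynomial.mul_comp, Polynomial.C_comp,
    Polynomial.roots_C_mul _ (Polynomial.leadingCoeff_ne_zero.2 hP),
    Polynomial.multiset_prod_comp, Multiset.map_map, Polynomial.roots_multiset_prod,
    Multiset.bind_map, Multiset.bind_map]
  · refine Multiset.bind_congr fun y _ => ?_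
    simp only [Function.comp, Polynomial.sub_comp, Polynomial.X_comp, Polynomial.C_comp,
      Polynomial.C_add]
    congr 1
    ring
  · intro hmem
    obtain ⟨y, _, hy⟩ := Multiset.mem_map.1 hmem
    apply Polynomial.X_pow_sub_C_ne_zero hd (y + c)
    rw [← hy]
    simp only [Function.comp, Polynomial.sub_comp, Polynomial.X_comp, Polynomial.C_comp,
      Polynomial.C_add]
    ring

/-- Harmonics and Faber polynomials: if `f^d = g(q^d) + c` coefficientwise and
`d ∣ n`, then `F_{n,f}(X) = F_{n/d,g}(X^d − c)`; consequently the roots of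
`F_{n,f}` with multiplicity are exactly the `d`-th roots of the numbers `Y + c`
as `Y` ranges over the roots of `F_{n/d,g}` with multiplicity. -/
theorem faber_of_harmonic (f g : LaurentSeries ℂ) (hf : NormalizedLS f)
    (hg : NormalizedLS g) (d n : ℕ) (hd : 0 < d) (hn : 0 < n) (hdn : d ∣ n)
    (c : ℂ)
    (hpow : ∀ j : ℤ, (f ^ d).coeff j =
      (if (d : ℤ) ∣ j then g.coeff (j / (d : ℤ)) else 0) + (if j = 0 then c else 0))
    (Fn Fq : Polynomial ℂ) (hFn : IsFaberPoly f n Fn) (hFq : IsFaberPoly g (n / d) Fq) :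
    Fn = Fq.comp (Polynomial.X ^ d - Polynomial.C c) ∧
      Fn.roots =
        (Fq.roots.map (· + c)).bind
          (fun w => (Polynomial.X ^ d - Polynomial.C w).roots) := by
  have hdz : (0 : ℤ) < d := by exact_mod_cast hd
  have hle : ∀ a b : ℤ, (AddMonoidHom.mulLeft (d : ℤ)) a ≤ (AddMonoidHom.mulLeft (d : ℤ)) b
      ↔ a ≤ b := fun a b => mul_le_mul_iff_right₀ hdz
  have hinj : Function.Injective (AddMonoidHom.mulLeft (d : ℤ)) := fun a b hab =>
    mul_left_cancel₀ hdz.ne' hab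
  obtain ⟨φ, hφC, hφ1, hφ0⟩ : ∃ φ : LaurentSeries ℂ →+* LaurentSeries ℂ,
      (∀ r : ℂ, φ (HahnSeries.C r) = HahnSeries.C r) ∧
      (∀ (x : LaurentSeries ℂ) (j : ℤ), (φ x).coeff ((d : ℤ) * j) = x.coeff j) ∧
      (∀ (x : LaurentSeries ℂ) (j : ℤ), ¬ (d : ℤ) ∣ j → (φ x).coeff j = 0) := by
    refine ⟨HahnSeries.embDomainRingHom (AddMonoidHom.mulLeft (d : ℤ)) hinj hle,
      fun r => HahnSeries.embDomainRingHom_C, fun x j => ?_, fun x j hj => ?_⟩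
    · exact HahnSeries.embDomain_coeff
        (f := (⟨⟨AddMonoidHom.mulLeft (d : ℤ), hinj⟩, hle _ _⟩ : ℤ ↪o ℤ)) (x := x) (a := j)
    · apply HahnSeries.embDomain_of_notMem_range
      rintro ⟨a, ha⟩
      exact hj ⟨a, ha.symm⟩
  have hfd : f ^ d - HahnSeries.C c = φ g := by
    ext j
    rw [HahnSeries.coeff_sub, hpow, HahnSeries.C_apply, HahnSeries.coeff_single]
    by_cases hj : (d : ℤ) ∣ j
    · obtain ⟨k, rfl⟩ := hj
      rw [hφ1, if_pos (dvd_mul_right _ _), Int.mul_ediv_cancel_left _ hdz.ne']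
      split_ifs <;> ring
    · rw [hφ0 _ _ hj, if_neg hj]
      split_ifs <;> ring
  have hcomp : Polynomial.aeval f (Fq.comp (Polynomial.X ^ d - Polynomial.C c))
      = φ (Polynomial.aeval g Fq) := by
    rw [aux_aeval, aux_aeval, Polynomial.eval₂_comp, Polynomial.hom_eval₂, ← hfd]
    congr 1
    · ext1 r
      exact (hφC r).symm
    · simp
  have hmain : Fn = Fq.comp (Polynomial.X ^ d - Polynomial.C c) := by
    rw [← sub_eq_zero]
    apply aux_unique f hf
    intro j hj
    have h1 := hFn j hj
    rw [HahnSeries.coeff_sub, sub_eq_zero] at h1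
    rw [map_sub, HahnSeries.coeff_sub, h1, hcomp, sub_eq_zero, HahnSeries.coeff_single]
    obtain ⟨m, rfl⟩ := hdn
    rw [Nat.mul_div_cancel_left _ hd] at hFq
    by_cases hjd : (d : ℤ) ∣ j
    · obtain ⟨k, rfl⟩ := hjd
      have hk : k ≤ 0 := by
        by_contra! hk
        exact absurd (mul_pos hdz hk) (not_lt.2 hj)
      have h2 := hFq k hk
      rw [HahnSeries.coeff_sub, sub_eq_zero, HahnSeries.coeff_single] at h2
      rw [hφ1, h2]
      have : (d : ℤ) * k = -((d * m : ℕ) : ℤ) ↔ k = -(m : ℤ) := by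
        push_cast
        rw [← mul_neg, mul_right_inj' hdz.ne']
      by_cases hkm : k = -(m : ℤ)
      · rw [if_pos hkm, if_pos (this.2 hkm)]
      · rw [if_neg hkm, if_neg (fun h => hkm (this.1 h))]
    · rw [hφ0 _ _ hjd, if_neg]
      rintro rfl
      apply hjd
      push_cast
      exact (dvd_mul_right _ _).neg_right
  refine ⟨hmain, ?_⟩
  rw [hmain]
  exact aux_roots Fq d hd c
end

section
/- Let m be a squarefree positive integer and let h, n be positive integers with gcd(n, h) = 1. Then for all positive integers a, d with a·d = n and every integer b with 0 ≤ b < d and gcd(a, gcd(b, d)) = 1, there exist an exact divisor k of m and integers w, x, y, z with y > 0 and k·w·z − (m/k)·x·y = 1 such that a = gcd(n, (m/k)·y), a·k divides m·y, and z ≡ b·h·((m·y)/(a·k)) (mod d). (That is, the map φ_n from Γ₀(mh∣h)+ to the reduced Hecke set H_n* is surjective.) -/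
theorem aux_coprime_shift (a : ℕ) (ha : 0 < a) (c d : ℤ)
    (H : ∀ p : ℕ, p.Prime → p ∣ a → (p : ℤ) ∣ c → (p : ℤ) ∣ d → False) :
    ∃ j : ℤ, IsCoprime (c + d * j) (a : ℤ) := by
  classical
  let S := a.primeFactors.filter (fun p : ℕ => ¬ (p : ℤ) ∣ c)
  refine ⟨((∏ p ∈ S, p : ℕ) : ℤ), ?_⟩
  rw [Int.isCoprime_iff_gcd_eq_one]
  by_contra hne
  obtain ⟨p, hp, hpd⟩ := Nat.exists_prime_and_dvd hne
  have hp1 : (p : ℤ) ∣ c + d * ((∏ p ∈ S, p : ℕ) : ℤ) :=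
    (Int.natCast_dvd_natCast.2 hpd).trans (Int.gcd_dvd_left _ _)
  have hp2 : p ∣ a :=
    Int.natCast_dvd_natCast.1 ((Int.natCast_dvd_natCast.2 hpd).trans (Int.gcd_dvd_right _ _))
  by_cases hc : (p : ℤ) ∣ c
  · have h3 := (dvd_add_right hc).1 hp1
    rcases (Nat.prime_iff_prime_int.1 hp).dvd_or_dvd h3 with h4 | h4
    · exact H p hp hp2 hc h4
    · have h5 := Int.natCast_dvd_natCast.1 h4
      obtain ⟨q, hq, hpq⟩ := (hp.prime.dvd_finset_prod_iff _).1 h5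
      have hq' := Finset.mem_filter.1 hq
      have : p = q := (Nat.prime_dvd_prime_iff_eq hp (Nat.prime_of_mem_primeFactors hq'.1)).1 hpq
      exact hq'.2 (this ▸ hc)
  · have hmem : p ∈ S := Finset.mem_filter.2 ⟨Nat.mem_primeFactors.2 ⟨hp, hp2, ha.ne'⟩, hc⟩
    have h5 : (p : ℤ) ∣ ((∏ p ∈ S, p : ℕ) : ℤ) :=
      Int.natCast_dvd_natCast.2 (Finset.dvd_prod_of_mem (fun p : ℕ => p) hmem)
    exact hc ((dvd_add_left (h5.mul_left d)).1 hp1)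

/-- Surjectivity of `φ_n` onto the reduced Hecke set: let `m` be squarefree,
`gcd(n,h) = 1`.  For every `[[a,b],[0,d]]` with `a·d = n`, `0 ≤ b < d` and
`gcd(a, b, d) = 1`, there is a canonical coset representative
`[[khw, x],[mh²y, khz]]` of `Γ₀(mh∣h)+` (so `k` is an exact divisor of `m`,
`y > 0` and `kwz − (m/k)xy = 1`) with `a = gcd(n, (m/k)·y)`, `a·k ∣ m·y` and
`z ≡ b·h·((m·y)/(a·k)) (mod d)`. -/
theorem phi_n_surjective (m h n : ℕ) (hm : Squarefree m) (hm0 : 0 < m)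
    (hh : 0 < h) (hn : 0 < n) (hnh : Nat.gcd n h = 1)
    (a d : ℕ) (ha : 0 < a) (hd : 0 < d) (had : a * d = n)
    (b : ℤ) (hb0 : 0 ≤ b) (hbd : b < (d : ℤ))
    (hred : Nat.gcd a (Int.gcd b (d : ℤ)) = 1) :
    ∃ (k : ℕ) (w x y z : ℤ), (k ∣ m ∧ Nat.gcd k (m / k) = 1) ∧ 0 < y ∧
      (k : ℤ) * w * z - ((m / k : ℕ) : ℤ) * x * y = 1 ∧
      (a : ℤ) = (Int.gcd (n : ℤ) (((m / k : ℕ) : ℤ) * y) : ℤ) ∧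
      (a : ℤ) * (k : ℤ) ∣ (m : ℤ) * y ∧
      z ≡ b * (h : ℤ) * (((m : ℤ) * y) / ((a : ℤ) * (k : ℤ))) [ZMOD (d : ℤ)] := by
  obtain ⟨j, hj⟩ := aux_coprime_shift a ha (b * h) d (by
    intro p hp hpa hpc hpd
    rcases (Nat.prime_iff_prime_int.1 hp).dvd_or_dvd hpc with h1 | h1
    · have h2 : p ∣ Nat.gcd a (Int.gcd b (d : ℤ)) :=
        Nat.dvd_gcd hpa (Int.natCast_dvd_natCast.1 (Int.dvd_coe_gcd h1 hpd))
      rw [hred] at h2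
      exact hp.one_lt.ne' (Nat.dvd_one.1 h2)
    · have h2 : p ∣ Nat.gcd n h :=
        Nat.dvd_gcd (had ▸ hpa.mul_right d) (Int.natCast_dvd_natCast.1 h1)
      rw [hnh] at h2
      exact hp.one_lt.ne' (Nat.dvd_one.1 h2))
  obtain ⟨k, hk⟩ := Nat.gcd_dvd_left m a
  obtain ⟨y, hy⟩ := Nat.gcd_dvd_right m a
  set M := Nat.gcd m a with hM
  have hM0 : 0 < M := Nat.gcd_pos_of_pos_left _ hm0
  have hk0 : 0 < k := Nat.pos_of_ne_zero (by rintro rfl; simp at hk; omega)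
  have hy0 : 0 < y := Nat.pos_of_ne_zero (by rintro rfl; simp at hy; omega)
  have hmk : m / k = M := by rw [hk]; exact Nat.mul_div_cancel _ hk0
  have hcop : Nat.Coprime M k := by
    rw [hk] at hm
    exact Nat.coprime_of_squarefree_mul hm
  have hky : Nat.Coprime k y := by
    have h1 : Nat.gcd k y = 1 := by
      have h2 : Nat.gcd (M * k) (M * y) = M := by rw [← hk, ← hy]
      rw [Nat.gcd_mul_left] at h2
      exact Nat.eq_of_mul_eq_mul_left hM0 (by rw [h2, mul_one])
    exact h1
  have hka : Nat.Coprime k a := by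
    rw [hy]
    exact Nat.Coprime.mul_right hcop.symm hky
  have hka' : IsCoprime (k : ℤ) (a : ℤ) := Nat.isCoprime_iff_coprime.2 hka
  obtain ⟨u, v, huv⟩ := hka'.mul_left hj
  have hyZ : (M : ℤ) * y = a := by exact_mod_cast hy.symm
  have hkZ : (m : ℤ) = M * k := by exact_mod_cast hk
  have hmy : (m : ℤ) * y = a * k := by rw [hkZ, ← hyZ]; ring
  refine ⟨k, u, -v, y, b * h + d * j, ⟨⟨M, by rw [hk, mul_comm]⟩, ?_⟩, by exact_mod_cast hy0,
    ?_, ?_, ?_, ?_⟩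
  · rw [hmk]; exact hcop.symm
  · rw [hmk]
    linear_combination huv + v * hyZ
  · rw [hmk, hyZ, Int.gcd_natCast_natCast, ← had, Nat.gcd_eq_right (Dvd.intro _ rfl)]
  · rw [hmy]
  · rw [hmy, Int.ediv_self (by positivity), mul_one]
    exact (Int.modEq_iff_dvd.2 ⟨-j, by ring⟩)
end

section
/- Let m be a squarefree positive integer, h a positive integer, and let Γ = Γ₀(mh∣h)+ be the set of Möbius transformations of ℍ induced by integer matrices [[k·h·w, x],[m·h²·y, k·h·z]] with k an exact divisor of m and k·w·z − (m/k)·x·y = 1. If τ ∈ ℍ satisfies Im Kτ ≤ Im τ for all K ∈ Γ, then Im τ ≥ √3/(2·m·h). -/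
/-- Let `m` be squarefree, `h ≥ 1`, and let `τ` be a point of the upper
half-plane whose imaginary part is not increased by any element of
`Γ₀(mh∣h)+` (the group of Möbius transformations induced by the matrices
`[[khw, x],[mh²y, khz]]` with `k` an exact divisor of `m` and
`kwz − (m/k)xy = 1`).  Then `Im τ ≥ √3/(2mh)`. -/
theorem single_cusp_imaginary_bound (m h : ℕ) (hm : Squarefree m) (hm0 : 0 < m)
    (hh : 0 < h) (τ : ℂ) (hτ : 0 < τ.im)
    (hbd : ∀ (k : ℕ) (w x y z : ℤ),
      (k ∣ m ∧ Nat.gcd k (m / k) = 1) →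
      (k : ℤ) * w * z - ((m / k : ℕ) : ℤ) * x * y = 1 →
      ((((k : ℂ) * h * w) * τ + (x : ℂ)) /
          (((m : ℂ) * h ^ 2 * y) * τ + (k : ℂ) * h * z)).im ≤ τ.im) :
    Real.sqrt 3 / (2 * m * h) ≤ τ.im := by
  obtain ⟨a, b⟩ := τ
  simp only at hτ ⊢
  have hmR : (0:ℝ) < m := by exact_mod_cast hm0
  have hhR : (0:ℝ) < h := by exact_mod_cast hh
  set n : ℤ := round ((m:ℝ) * h * a) with hn
  have hround : |(m:ℝ) * h * a - n| ≤ 1 / 2 := abs_sub_round _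
  set k : ℕ := Nat.gcd n.natAbs m with hk
  have hkm : k ∣ m := Nat.gcd_dvd_right _ _
  have hkn : (k:ℤ) ∣ n := Int.natCast_dvd.mpr (Nat.gcd_dvd_left _ _)
  obtain ⟨q, hq⟩ := hkm
  have hk0 : 0 < k := Nat.gcd_pos_of_pos_right _ hm0
  have hmk : m / k = q := by rw [hq]; exact Nat.mul_div_cancel_left _ hk0
  have hcopkq : Nat.Coprime k q := by
    rw [hq] at hm
    exact Nat.coprime_of_squarefree_mul hm
  have hcop : Nat.Coprime n.natAbs q := by
    have h1 : Nat.gcd n.natAbs q ∣ k :=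
      Nat.dvd_gcd (Nat.gcd_dvd_left _ _) ((Nat.gcd_dvd_right _ _).trans ⟨k, by rw [mul_comm]; exact hq⟩)
    exact Nat.eq_one_of_dvd_coprimes hcopkq h1 (Nat.gcd_dvd_right _ _)
  have hcopZ : IsCoprime n (q:ℤ) := by
    rw [Int.isCoprime_iff_gcd_eq_one]; exact hcop
  obtain ⟨u, v, huv⟩ := hcopZ
  obtain ⟨z, hz⟩ := hkn
  have hdet : (k:ℤ) * (-u) * (-z) - ((m / k : ℕ) : ℤ) * (-v) * 1 = 1 := by
    have h2 : u * (k * z) + v * q = 1 := by rw [← hz]; exact huv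
    rw [hmk]; linarith
  have key := hbd k (-u) (-v) 1 (-z) ⟨⟨q, hq⟩, by rw [hmk]; exact hcopkq⟩ hdet
  have hdetR : (k:ℝ) * u * z + q * v = 1 := by
    rw [hmk] at hdet
    have : (k:ℤ) * u * z + q * v = 1 := by linarith
    exact_mod_cast this
  have hzR : (n:ℝ) = k * z := by exact_mod_cast hz
  have hqR : (m:ℝ) = k * q := by exact_mod_cast hq
  have hk1 : (1:ℝ) ≤ k := by exact_mod_cast hk0
  have hD : (0:ℝ) < (m * h * a - n) ^ 2 + (m * h * b) ^ 2 := by positivity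
  have e : ((((k : ℂ) * h * ((-u : ℤ) : ℂ)) * (⟨a, b⟩ : ℂ) + ((-v : ℤ) : ℂ)) /
          (((m : ℂ) * h ^ 2 * ((1 : ℤ) : ℂ)) * (⟨a, b⟩ : ℂ) + (k : ℂ) * h * ((-z : ℤ) : ℂ))).im
      = k * b / ((m * h * a - n) ^ 2 + (m * h * b) ^ 2) := by
    have hN : ((k : ℂ) * h * ((-u : ℤ) : ℂ)) * (⟨a, b⟩ : ℂ) + ((-v : ℤ) : ℂ)
        = ⟨-(k * h * u * a) - v, -(k * h * u * b)⟩ := by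
      apply Complex.ext <;> simp <;> ring
    have hDen : ((m : ℂ) * h ^ 2 * ((1 : ℤ) : ℂ)) * (⟨a, b⟩ : ℂ) + (k : ℂ) * h * ((-z : ℤ) : ℂ)
        = ⟨h * (m * h * a - n), h * (m * h * b)⟩ := by
      rw [hzR]
      apply Complex.ext <;> simp [← Complex.ofReal_natCast, ← Complex.ofReal_pow] <;> ring
    rw [hN, hDen, Complex.div_im, Complex.normSq_mk]
    simp only
    have e2 : (h:ℝ) * (m * h * a - n) * (h * (m * h * a - n)) + h * (m * h * b) * (h * (m * h * b))
       = h ^ 2 * ((m * h * a - n) ^ 2 + (m * h * b) ^ 2) := by ring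
    rw [e2, ← sub_div, div_eq_div_iff (by positivity) hD.ne']
    have e3 : -((k:ℝ) * h * u * b) * (h * (m * h * a - n)) - (-(k * h * u * a) - v) * (h * (m * h * b))
       = k * b * h ^ 2 * (k * u * z + q * v) := by
      rw [hzR, hqR]; ring
    rw [e3, hdetR]; ring
  rw [e] at key
  simp only at key
  rw [div_le_iff₀ hD] at key
  have hkD : (k:ℝ) ≤ (m * h * a - n) ^ 2 + (m * h * b) ^ 2 := by
    by_contra hc
    push Not at hc
    nlinarith
  have hsq : ((m:ℝ) * h * a - n) ^ 2 ≤ 1 / 4 := by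
    have := abs_le.mp hround
    nlinarith
  have h3 : Real.sqrt 3 ≤ 2 * (m * h * b) := by
    apply Real.sqrt_le_iff.mpr
    constructor
    · positivity
    · nlinarith
  rw [div_le_iff₀ (by positivity)]
  linarith
end

section
/- Let m, h be positive integers and E a set of exact divisors of m, and suppose that both Γ₀(mh∣h)+E and Γ₀(m)+E (the case h = 1 of the same construction) are groups of Möbius transformations of ℍ. Then a point τ ∈ ℍ satisfies the fundamental-domain conditions for Γ₀(mh∣h)+E with width 1/h if and only if h·τ satisfies the fundamental-domain conditions for Γ₀(m)+E with width 1. In other words, the fundamental domain of Γ₀(mh∣h)+E is the image of the fundamental domain of Γ₀(m)+E under τ ↦ τ/h. -/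
open UpperHalfPlane

/-- Conjugation by the scaling `τ ↦ hτ` sends `Γ₀(mh∣h)+E` into `Γ₀(m)+E`. -/
lemma gamma_conj_forward (m h : ℕ) (hh : 0 < h) (E : Set ℕ) (c : {x : ℝ // 0 < x})
    (hc : (c : ℝ) = h) (f : UpperHalfPlane → UpperHalfPlane) (hf : f ∈ GammaSet m h E) :
    (fun σ => c • f (c⁻¹ • σ)) ∈ GammaSet m 1 E := by
  obtain ⟨k, w, x, y, z, hk, hdet, hM⟩ := hf
  refine ⟨k, w, x, y, z, hk, hdet, fun σ => ?_⟩
  have hh' : (h : ℂ) ≠ 0 := by exact_mod_cast hh.ne'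
  have e := hM (c⁻¹ • σ)
  simp only [coe_pos_real_smul, Positive.coe_inv, hc, e, Complex.real_smul]
  push_cast
  have e2 : (m : ℂ) * (h : ℂ) ^ 2 * y * ((h : ℂ)⁻¹ * σ) + k * h * z
      = h * (m * 1 * y * σ + k * 1 * z) := by
    field_simp
  have e1 : (k : ℂ) * h * w * ((h : ℂ)⁻¹ * σ) + x = k * 1 * w * σ + x := by
    field_simp
  rw [e1, e2, ← mul_div_assoc, mul_div_mul_left _ _ hh']

/-- Conjugation by `τ ↦ τ/h` sends `Γ₀(m)+E` into `Γ₀(mh∣h)+E`. -/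
lemma gamma_conj_backward (m h : ℕ) (hh : 0 < h) (E : Set ℕ) (c : {x : ℝ // 0 < x})
    (hc : (c : ℝ) = h) (f : UpperHalfPlane → UpperHalfPlane) (hf : f ∈ GammaSet m 1 E) :
    (fun σ => c⁻¹ • f (c • σ)) ∈ GammaSet m h E := by
  obtain ⟨k, w, x, y, z, hk, hdet, hM⟩ := hf
  refine ⟨k, w, x, y, z, hk, hdet, fun σ => ?_⟩
  have hh' : (h : ℂ) ≠ 0 := by exact_mod_cast hh.ne'
  have e := hM (c • σ)
  simp only [coe_pos_real_smul, Positive.coe_inv, hc, e, Complex.real_smul]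
  push_cast
  have e2 : (m : ℂ) * (h : ℂ) ^ 2 * y * σ + k * h * z
      = h * (m * 1 * y * (h * σ) + k * 1 * z) := by
    ring
  have e1 : (k : ℂ) * h * w * σ + x = k * 1 * w * (h * σ) + x := by
    ring
  rw [e1, e2, inv_mul_eq_div, div_div, mul_comm (h : ℂ) (_ + _)]

/-- The conditions at `τ` follow from those at `cτ`, for scaled groups and strips. -/
lemma fd_conj (Γ Γ' : Set (UpperHalfPlane → UpperHalfPlane)) (h h' : ℕ)
    (c : {x : ℝ // 0 < x})
    (hw : (c : ℝ) * (1 / (2 * (h : ℝ))) = 1 / (2 * (h' : ℝ)))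
    (h1 : ∀ f ∈ Γ, (fun σ => c • f (c⁻¹ • σ)) ∈ Γ')
    (h2 : ∀ f ∈ Γ', (fun σ => c⁻¹ • f (c • σ)) ∈ Γ)
    (τ : UpperHalfPlane) (H : FDConds Γ' h' (c • τ)) : FDConds Γ h τ := by
  have c0 : 0 < (c : ℝ) := c.2
  obtain ⟨a, ⟨b1, b2⟩, d⟩ := H
  simp only [pos_real_re, ← hw, pos_real_im] at a b1 b2 d
  refine ⟨fun K hK => ?_, ⟨?_, ?_⟩, fun K hK ⟨p, q, r⟩ => ?_⟩
  · have := a _ (h1 K hK)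
    simp only [inv_smul_smul, pos_real_im] at this
    exact le_of_mul_le_mul_left this c0
  · exact lt_of_mul_lt_mul_left (by linarith) c0.le
  · exact le_of_mul_le_mul_left b2 c0
  · have := d _ (h1 K hK)
    simp only [inv_smul_smul, pos_real_im, pos_real_re] at this
    refine le_of_mul_le_mul_left (this ⟨fun K' hK' => ?_, ?_, ?_⟩) c0
    · have t := p _ (h2 K' hK')
      simp only [pos_real_im, Positive.coe_inv] at t
      rwa [inv_mul_le_iff₀ c0] at t
    · have := mul_lt_mul_of_pos_left q c0
      linarith
    · exact mul_le_mul_of_nonneg_left r c0.le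

/-- Conjugate fundamental domains: a point `τ ∈ ℍ` satisfies the
fundamental-domain conditions for `Γ₀(mh∣h)+E` with width `1/h` if and only if
`h·τ` satisfies the fundamental-domain conditions for `Γ₀(m)+E` with width `1`;
that is, `𝒟(Γ₀(mh∣h)+E)` is the image of `𝒟(Γ₀(m)+E)` under `τ ↦ τ/h`. -/
theorem fundamental_domain_conjugate (m h : ℕ) (hm : 0 < m) (hh : 0 < h)
    (E : Set ℕ) (hE : ∀ k ∈ E, k ∣ m ∧ Nat.gcd k (m / k) = 1)
    (hgrp : IsGroupUnderComp (GammaSet m h E))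
    (hgrp1 : IsGroupUnderComp (GammaSet m 1 E))
    (τ τ' : UpperHalfPlane) (hττ' : (τ' : ℂ) = (h : ℂ) * (τ : ℂ)) :
    FDConds (GammaSet m h E) h τ ↔ FDConds (GammaSet m 1 E) 1 τ' := by
  have hr : (0 : ℝ) < h := by exact_mod_cast hh
  obtain ⟨c, hc⟩ : ∃ c : {x : ℝ // 0 < x}, (c : ℝ) = h := ⟨⟨h, hr⟩, rfl⟩
  have e : τ' = c • τ := by
    apply UpperHalfPlane.ext
    rw [hττ', coe_pos_real_smul, hc, Complex.real_smul]
    push_cast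
    rfl
  subst e
  have F := gamma_conj_forward m h hh E c hc
  have B := gamma_conj_backward m h hh E c hc
  constructor
  · intro H
    refine fd_conj _ (GammaSet m h E) 1 h c⁻¹ ?_ ?_ ?_ _ ?_
    · rw [Positive.coe_inv, hc]
      push_cast
      field_simp
    · simpa only [inv_inv] using B
    · simpa only [inv_inv] using F
    · simpa only [inv_smul_smul] using H
  · intro H
    refine fd_conj _ (GammaSet m 1 E) h 1 c ?_ F B _ H
    rw [hc]
    push_cast
    field_simp
end

section
/- Let m, h be positive integers, E a set of exact divisors of m, and suppose Γ = Γ₀(mh∣h)+E is a group of Möbius transformations of ℍ. Let τ ∈ ℍ satisfy the fundamental-domain conditions for Γ with width 1/h. Then the following are equivalent: (a) for every ε > 0, the point τ − iε fails to satisfy the fundamental-domain conditions (or lies outside ℍ); (b) there exists K ∈ Γ that does not fix ∞ (i.e., K is induced by a matrix with nonzero lower-left entry) such that Im Kτ = Im τ. -/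
open UpperHalfPlane

/-- Real and imaginary parts of the defining equation. -/
lemma moebius_parts {A B C D : ℤ} {f : UpperHalfPlane → UpperHalfPlane}
    (hf : IsMoebiusOf A B C D f) (τ : UpperHalfPlane) :
    (f τ).re * (C * τ.re + D) - (f τ).im * (C * τ.im) = A * τ.re + B ∧
    (f τ).re * (C * τ.im) + (f τ).im * (C * τ.re + D) = A * τ.im := by
  have h1 := hf τ
  have hne : (C : ℂ) * (τ : ℂ) + (D : ℂ) ≠ 0 := by
    intro h0
    rw [h0, div_zero] at h1
    have := (f τ).im_pos
    rw [← UpperHalfPlane.coe_im, h1] at this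
    simp at this
  rw [eq_div_iff hne] at h1
  have hr := congrArg Complex.re h1
  have hi := congrArg Complex.im h1
  simp at hr hi
  exact ⟨by linarith, by linarith⟩

/-- The quadratic form deciding whether the imaginary part increases. -/
noncomputable def qform (m h k : ℕ) (y z : ℤ) (r t : ℝ) : ℝ :=
  ((m : ℝ) * h * y * r + k * z) ^ 2 + ((m : ℝ) * h * y * t) ^ 2

lemma gamma_im {m h k : ℕ} (hm : 0 < m) (hh : 0 < h) (hk : k ∣ m) {w x y z : ℤ}
    (hdet : (k : ℤ) * w * z - ((m / k : ℕ) : ℤ) * x * y = 1)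
    {f : UpperHalfPlane → UpperHalfPlane}
    (hf : IsMoebiusOf ((k : ℤ) * (h : ℤ) * w) x ((m : ℤ) * (h : ℤ) ^ 2 * y)
        ((k : ℤ) * (h : ℤ) * z) f) (τ : UpperHalfPlane) :
    (f τ).im * qform m h k y z τ.re τ.im = k * τ.im := by
  obtain ⟨e1, e2⟩ := moebius_parts hf τ
  push_cast at e1 e2
  have hmk0 : m = k * (m / k) := (Nat.mul_div_cancel' hk).symm
  generalize m / k = n at hdet hmk0
  have hmk : (m : ℝ) = k * (n : ℝ) := by exact_mod_cast hmk0
  have hd : (k : ℝ) * w * z - (n : ℝ) * x * y = 1 := by exact_mod_cast hdet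
  have hh' : (h : ℝ) ^ 2 ≠ 0 := by positivity
  apply mul_left_cancel₀ hh'
  unfold qform
  linear_combination ((m : ℝ) * h ^ 2 * y * τ.re + k * h * z) * e2
    - ((m : ℝ) * h ^ 2 * y * τ.im) * e1 + (k * h ^ 2 * τ.im) * hd
    - (h ^ 2 * x * y * τ.im) * hmk

lemma k_le {m k : ℕ} (hm : 0 < m) (hk : k ∣ m) : 0 < k ∧ k ≤ m :=
  ⟨Nat.pos_of_dvd_of_pos hk hm, Nat.le_of_dvd hm hk⟩

/-- Far away from the origin the form is automatically large. -/
lemma exists_box (m h : ℕ) (hm : 0 < m) (hh : 0 < h) (r t : ℝ) (ht : 0 < t) :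
    ∃ N : ℕ, ∀ (k : ℕ) (y z : ℤ) (s : ℝ), 0 < k → k ≤ m → t / 2 ≤ s →
      ¬ (|y| ≤ N ∧ |z| ≤ N) → (k : ℝ) < qform m h k y z r s := by
  obtain ⟨N1, hN1⟩ := exists_nat_gt (2 * m / t)
  obtain ⟨N2, hN2⟩ := exists_nat_gt ((m : ℝ) * h * N1 * |r| + m)
  refine ⟨max N1 N2, fun k y z s hk hkm hs hbox => ?_⟩
  have hm1 : (1 : ℝ) ≤ m := by exact_mod_cast hm
  have hh1 : (1 : ℝ) ≤ h := by exact_mod_cast hh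
  have hk1 : (1 : ℝ) ≤ k := by exact_mod_cast hk
  have hkm' : (k : ℝ) ≤ m := by exact_mod_cast hkm
  have hmh : (1 : ℝ) ≤ m * h := by nlinarith
  unfold qform
  by_cases hy : |y| ≤ N1
  · have hz : (N2 : ℤ) < |z| := by
      by_contra hz
      exact hbox ⟨hy.trans (by simp), (not_lt.mp hz).trans (by simp)⟩
    have hy' : |(y : ℝ)| ≤ N1 := by exact_mod_cast hy
    have hz' : (N2 : ℝ) < |(z : ℝ)| := by exact_mod_cast hz
    have h1 : |(k : ℝ) * z| ≤ |(m : ℝ) * h * y * r + k * z| + |(m : ℝ) * h * y * r| := by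
      have := abs_sub ((m : ℝ) * h * y * r + k * z) ((m : ℝ) * h * y * r)
      rwa [add_sub_cancel_left] at this
    have h2 : |(m : ℝ) * h * y * r| ≤ (m : ℝ) * h * N1 * |r| := by
      rw [abs_mul, abs_mul, abs_of_nonneg (by positivity : (0 : ℝ) ≤ (m : ℝ) * h)]
      gcongr
    have h3 : |(z : ℝ)| ≤ |(k : ℝ) * z| := by
      rw [abs_mul, abs_of_nonneg (by positivity : (0 : ℝ) ≤ (k : ℝ))]
      nlinarith [abs_nonneg (z : ℝ)]
    have h4 : (m : ℝ) < |(m : ℝ) * h * y * r + k * z| := by linarith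
    rw [← sq_abs ((m : ℝ) * h * y * r + k * z)]
    nlinarith [sq_nonneg ((m : ℝ) * h * y * s)]
  · have hy' : (N1 : ℝ) < |(y : ℝ)| := by exact_mod_cast not_le.mp hy
    have h1 : (m : ℝ) < |(y : ℝ)| * (t / 2) := by
      have := hN1.trans hy'
      rw [div_lt_iff₀ ht] at this
      linarith
    have h2 : |(y : ℝ)| * (t / 2) ≤ |(m : ℝ) * h * y * s| := by
      rw [abs_mul, abs_mul, abs_of_nonneg (by positivity : (0 : ℝ) ≤ (m : ℝ) * h),
        abs_of_nonneg (by linarith : (0 : ℝ) ≤ s)]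
      have : |(y : ℝ)| ≤ m * h * |(y : ℝ)| := by nlinarith [abs_nonneg (y : ℝ)]
      gcongr
    rw [← sq_abs ((m : ℝ) * h * y * s)]
    nlinarith [sq_nonneg ((m : ℝ) * h * y * r + k * z)]

/-- Local finiteness: strict inequalities persist slightly below the point. -/
lemma exists_eps (m h : ℕ) (hm : 0 < m) (hh : 0 < h) (r t : ℝ) (ht : 0 < t) :
    ∃ ε : ℝ, 0 < ε ∧ ε < t ∧ ∀ (k : ℕ) (y z : ℤ), 0 < k → k ≤ m →
      (k : ℝ) < qform m h k y z r t → (k : ℝ) < qform m h k y z r (t - ε) := by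
  obtain ⟨N, hN⟩ := exists_box m h hm hh r t ht
  have key : ∀ p ∈ (Finset.Icc 0 m ×ˢ Finset.Icc (-(N : ℤ)) N ×ˢ Finset.Icc (-(N : ℤ)) N),
      ∀ᶠ ε in nhdsWithin (0 : ℝ) (Set.Ioi 0),
        ((p.1 : ℝ) < qform m h p.1 p.2.1 p.2.2 r t →
          (p.1 : ℝ) < qform m h p.1 p.2.1 p.2.2 r (t - ε)) := by
    intro p _
    by_cases hp : (p.1 : ℝ) < qform m h p.1 p.2.1 p.2.2 r t
    · have hc : Continuous fun ε : ℝ => qform m h p.1 p.2.1 p.2.2 r (t - ε) := by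
        unfold qform; fun_prop
      have := (hc.tendsto 0).eventually (lt_mem_nhds (a := (p.1 : ℝ)) (by simpa using hp))
      filter_upwards [nhdsWithin_le_nhds this] with ε hε _
      exact hε
    · exact Filter.Eventually.of_forall fun ε h => absurd h hp
  have key2 := (Filter.eventually_all_finset _).2 key
  have h3 : ∀ᶠ ε in nhdsWithin (0 : ℝ) (Set.Ioi 0), ε ∈ Set.Ioo (0 : ℝ) (t / 2) :=
    Ioo_mem_nhdsGT (by linarith)
  obtain ⟨ε, hε, h0, h1⟩ := (key2.and h3).exists
  refine ⟨ε, h0, by linarith, fun k y z hk hkm hq => ?_⟩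
  by_cases hb : |y| ≤ N ∧ |z| ≤ N
  · refine hε (k, y, z) ?_ hq
    simp only [Finset.mem_product, Finset.mem_Icc]
    exact ⟨⟨Nat.zero_le _, hkm⟩, abs_le.mp hb.1, abs_le.mp hb.2⟩
  · exact hN k y z _ hk hkm (by linarith) hb

/-- Elements with `y = 0` are translations by multiples of `1/h`. -/
lemma gamma_trans {m h k : ℕ} {w x z : ℤ}
    (hdet : (k : ℤ) * w * z - ((m / k : ℕ) : ℤ) * x * 0 = 1)
    {f : UpperHalfPlane → UpperHalfPlane}
    (hf : IsMoebiusOf ((k : ℤ) * (h : ℤ) * w) x ((m : ℤ) * (h : ℤ) ^ 2 * 0)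
        ((k : ℤ) * (h : ℤ) * z) f) (τ : UpperHalfPlane) :
    k = 1 ∧ z ^ 2 = 1 ∧ ∃ n : ℤ, h * ((f τ).re - τ.re) = n := by
  have hd : (k : ℤ) * (w * z) = 1 := by linarith
  have hk : k = 1 := by
    have : (k : ℤ) ∣ 1 := ⟨_, hd.symm⟩
    have : k ∣ 1 := by exact_mod_cast this
    simpa using this
  subst hk
  have hwz : w * z = 1 := by simpa using hd
  have hz : z = w ∧ z ^ 2 = 1 := by
    rcases Int.mul_eq_one_iff_eq_one_or_neg_one.mp hwz with ⟨rfl, rfl⟩ | ⟨rfl, rfl⟩ <;> simp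
  refine ⟨rfl, hz.2, x * z, ?_⟩
  obtain ⟨e1, -⟩ := moebius_parts hf τ
  push_cast at e1 ⊢
  have hz2 : (z : ℝ) ^ 2 = 1 := by exact_mod_cast hz.2
  rw [← hz.1] at e1
  linear_combination (z : ℝ) * e1 - (h * ((f τ).re - τ.re)) * hz2

/-- Lower-boundary criterion: let `τ` satisfy the fundamental-domain conditions
for `Γ = Γ₀(mh∣h)+E` with width `1/h`.  Then the following are equivalent:
(a) for every `ε > 0` the point `τ − iε` fails the fundamental-domain
conditions (or lies outside `ℍ`); (b) there is `K ∈ Γ` induced by a matrix with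
nonzero lower-left entry such that `Im Kτ = Im τ`. -/
theorem lower_boundary_iff_on_arc (m h : ℕ) (hm : 0 < m) (hh : 0 < h)
    (E : Set ℕ) (hE : ∀ k ∈ E, k ∣ m ∧ Nat.gcd k (m / k) = 1)
    (hgrp : IsGroupUnderComp (GammaSet m h E))
    (τ : UpperHalfPlane) (hτ : FDConds (GammaSet m h E) h τ) :
    (∀ ε : ℝ, 0 < ε → ∀ τε : UpperHalfPlane,
        (τε : ℂ) = (τ : ℂ) - ε * Complex.I → ¬ FDConds (GammaSet m h E) h τε) ↔
      (∃ f ∈ GammaSet m h E,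
        (∃ (k : ℕ) (w x y z : ℤ), k ∈ E ∧ y ≠ 0 ∧
          (k : ℤ) * w * z - ((m / k : ℕ) : ℤ) * x * y = 1 ∧
          IsMoebiusOf ((k : ℤ) * (h : ℤ) * w) x ((m : ℤ) * (h : ℤ) ^ 2 * y)
            ((k : ℤ) * (h : ℤ) * z) f) ∧
        (f τ).im = τ.im) := by
  constructor
  · intro ha
    by_contra hb
    have hstrict : ∀ f ∈ GammaSet m h E, ∀ (k : ℕ) (w x y z : ℤ), k ∈ E → y ≠ 0 →
        (k : ℤ) * w * z - ((m / k : ℕ) : ℤ) * x * y = 1 →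
        IsMoebiusOf ((k : ℤ) * (h : ℤ) * w) x ((m : ℤ) * (h : ℤ) ^ 2 * y)
            ((k : ℤ) * (h : ℤ) * z) f → (k : ℝ) < qform m h k y z τ.re τ.im := by
      intro f hf k w x y z hk hy hdet hM
      have hne : (f τ).im ≠ τ.im := fun he =>
        hb ⟨f, hf, ⟨k, w, x, y, z, hk, hy, hdet, hM⟩, he⟩
      have hlt := lt_of_le_of_ne (hτ.1 f hf) hne
      have hi := gamma_im hm hh (hE k hk).1 hdet hM τ
      have hp := (f τ).im_pos
      have hp2 := τ.im_pos
      have hk0 : (0 : ℝ) < k := by exact_mod_cast (k_le hm (hE k hk).1).1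
      by_contra hq
      push Not at hq
      nlinarith
    obtain ⟨ε, hε, hεt, hq⟩ := exists_eps m h hm hh τ.re τ.im τ.im_pos
    have hpos : 0 < ((τ : ℂ) - ε * Complex.I).im := by simpa using hεt
    let σ : UpperHalfPlane := ⟨(τ : ℂ) - ε * Complex.I, hpos⟩
    have hσ : (σ : ℂ) = (τ : ℂ) - ε * Complex.I := rfl
    have hre : σ.re = τ.re := by
      rw [← UpperHalfPlane.coe_re, hσ]; simp
    have him : σ.im = τ.im - ε := by
      rw [← UpperHalfPlane.coe_im, hσ]; simp
    have hlt : ∀ f ∈ GammaSet m h E, ∀ (k : ℕ) (w x y z : ℤ), k ∈ E → y ≠ 0 →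
        (k : ℤ) * w * z - ((m / k : ℕ) : ℤ) * x * y = 1 →
        IsMoebiusOf ((k : ℤ) * (h : ℤ) * w) x ((m : ℤ) * (h : ℤ) ^ 2 * y)
            ((k : ℤ) * (h : ℤ) * z) f → (f σ).im < σ.im := by
      intro f hf k w x y z hk hy hdet hM
      have hkk := k_le hm (hE k hk).1
      have h1 := hq k y z hkk.1 hkk.2 (hstrict f hf k w x y z hk hy hdet hM)
      have hi := gamma_im hm hh (hE k hk).1 hdet hM σ
      rw [← hre, ← him] at h1
      have hp := (f σ).im_pos
      have hp2 := σ.im_pos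
      have hk0 : (0 : ℝ) < k := by exact_mod_cast hkk.1
      by_contra hge
      push Not at hge
      nlinarith
    have hle : ∀ f ∈ GammaSet m h E, (f σ).im ≤ σ.im := by
      intro f hf
      obtain ⟨k, w, x, y, z, hk, hdet, hM⟩ := id hf
      by_cases hy : y = 0
      · subst hy
        obtain ⟨hk1, hz, -⟩ := gamma_trans hdet hM σ
        have hi := gamma_im hm hh (hE k hk).1 hdet hM σ
        have hz2 : (z : ℝ) ^ 2 = 1 := by exact_mod_cast hz
        subst hk1
        simp [qform, hz2] at hi
        exact le_of_eq (by exact_mod_cast hi)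
      · exact (hlt f hf k w x y z hk hy hdet hM).le
    refine ha ε hε σ hσ ⟨hle, by rw [hre]; exact hτ.2.1, ?_⟩
    rintro K hK ⟨hK1, hK2, hK3⟩
    obtain ⟨g, hg, -, hgK⟩ := hgrp.2.2 K hK
    have hback : σ.im ≤ (K σ).im := by
      have h1 := hK1 g hg
      have h2 : g (K σ) = σ := congrFun hgK σ
      rwa [h2] at h1
    obtain ⟨k, w, x, y, z, hk, hdet, hM⟩ := id hK
    by_cases hy : y = 0
    · subst hy
      obtain ⟨-, -, n, hn⟩ := gamma_trans hdet hM σ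
      have hh0 : (0 : ℝ) < h := by exact_mod_cast hh
      have hb1 := hτ.2.1
      rw [← hre] at hb1
      have hc : (h : ℝ) * (1 / (2 * (h : ℝ))) = 1 / 2 := by field_simp
      have h4 : (n : ℝ) < 1 := by
        rw [← hn]
        nlinarith [mul_lt_mul_of_pos_left hb1.1 hh0, mul_le_mul_of_nonneg_left hK3 hh0.le]
      have h5 : n ≤ 0 := by
        have : n < 1 := by exact_mod_cast h4
        omega
      have h6 : (n : ℝ) ≤ 0 := by exact_mod_cast h5
      by_contra hgt
      push Not at hgt
      nlinarith [mul_pos hh0 (sub_pos.mpr hgt)]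
    · exact absurd hback (not_le.mpr (hlt K hK k w x y z hk hy hdet hM))
  · rintro ⟨f, hf, ⟨k, w, x, y, z, hk, hy, hdet, hM⟩, heq⟩ ε hε σ hσ hFD
    have hre : σ.re = τ.re := by
      rw [← UpperHalfPlane.coe_re, hσ]; simp
    have him : σ.im = τ.im - ε := by
      rw [← UpperHalfPlane.coe_im, hσ]; simp
    have h1 := gamma_im hm hh (hE k hk).1 hdet hM τ
    have h2 := gamma_im hm hh (hE k hk).1 hdet hM σ
    have h3 := hFD.1 f hf
    have hτp := τ.im_pos
    have hσp := σ.im_pos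
    have hfp := (f σ).im_pos
    have hk0 : (0 : ℝ) < k := by exact_mod_cast (k_le hm (hE k hk).1).1
    have hq1 : qform m h k y z τ.re τ.im = k := by
      rw [heq, mul_comm] at h1
      exact mul_right_cancel₀ hτp.ne' h1
    have hc : (0 : ℝ) < ((m : ℝ) * h * y) ^ 2 := by
      have : (y : ℝ) ≠ 0 := by exact_mod_cast hy
      positivity
    have hs : σ.im ^ 2 < τ.im ^ 2 := by nlinarith
    have hq2 : qform m h k y z σ.re σ.im < k := by
      rw [← hq1, hre]
      unfold qform
      nlinarith [mul_lt_mul_of_pos_left hs hc]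
    nlinarith [mul_lt_mul_of_pos_left hq2 hfp]
end

section
/- Let m, h, y, z be positive integers, and let k be an exact divisor of m with gcd(k·z, (m/k)·y) = 1. Then gcd(m·h·k·z, m·h·y) · gcd(h·k·z, m·h·y) = k·m·h². Consequ268tly, for a matrix K = [[k·h·w, x],[m·h²·y, k·h·z]] with k·w·z − (m/k)·x·y = 1 one has ρ²(K) = (gcd(m·h·p, q)·gcd(h·p, q))/(m·h²·q²) where p/q = π(K), i.e., ρ²(K) = r²_{mh∣h}(π(K)). -/
/-- Let `m, h, y, z` be positive integers and `k` an exact divisor of `m` with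
`gcd(k·z, (m/k)·y) = 1`.  Then `gcd(mhkz, mhy)·gcd(hkz, mhy) = k·m·h²`.
Consequently, for a matrix `K = [[khw, x],[mh²y, khz]]` with `kwz − (m/k)xy = 1`,
one has `ρ²(K) = kh²/(mh²y)² = (gcd(mhp, q)·gcd(hp, q))/(mh²q²)` for any
representation `p/q` of `π(K) = −(kz)/(mhy)`, i.e. `ρ²(K) = r²_{mh∣h}(π(K))`. -/
theorem radius_from_pi (m h y z k : ℕ) (hm : 0 < m) (hh : 0 < h)
    (hy : 0 < y) (hz : 0 < z) (hkm : k ∣ m) (hex : Nat.gcd k (m / k) = 1)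
    (hcop : Nat.gcd (k * z) ((m / k) * y) = 1) :
    Nat.gcd (m * h * (k * z)) (m * h * y) * Nat.gcd (h * (k * z)) (m * h * y) =
      k * m * h ^ 2 ∧
    ∀ w x : ℤ, (k : ℤ) * w * (z : ℤ) - ((m / k : ℕ) : ℤ) * x * (y : ℤ) = 1 →
      ∀ p q : ℤ, 0 < q → (p : ℚ) / (q : ℚ) = -((k : ℚ) * z) / ((m : ℚ) * h * y) →
        ((k : ℚ) * h ^ 2) / ((m : ℚ) * h ^ 2 * y) ^ 2 =
          ((Int.gcd ((m : ℤ) * h * p) q : ℚ) * (Int.gcd ((h : ℤ) * p) q : ℚ)) /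
            ((m : ℚ) * h ^ 2 * q ^ 2) := by
  have hk : 0 < k := Nat.pos_of_dvd_of_pos hkm hm
  have key : Nat.gcd (m * h * (k * z)) (m * h * y) * Nat.gcd (h * (k * z)) (m * h * y) =
      k * m * h ^ 2 := by
    obtain ⟨n, rfl⟩ := hkm
    rw [Nat.mul_div_cancel_left n hk] at hcop
    have h1 : Nat.gcd (k * z) y = 1 := Nat.Coprime.coprime_mul_left_right hcop
    have h2 : Nat.gcd z (n * y) = 1 := Nat.Coprime.coprime_mul_left hcop
    have e1 : h * (k * z) = (h * k) * z := by ring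
    have e2 : k * n * h * y = (h * k) * (n * y) := by ring
    rw [Nat.gcd_mul_left, h1, e1, e2, Nat.gcd_mul_left, h2]
    ring
  refine ⟨key, ?_⟩
  intro w x _ p q hq hpq
  have hmQ : (0 : ℚ) < m := by exact_mod_cast hm
  have hhQ : (0 : ℚ) < h := by exact_mod_cast hh
  have hyQ : (0 : ℚ) < y := by exact_mod_cast hy
  have hqQ : (0 : ℚ) < q := by exact_mod_cast hq
  have hpq' : p * ((m : ℤ) * h * y) = -((k : ℤ) * z) * q := by
    rw [div_eq_div_iff hqQ.ne' (by positivity)] at hpq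
    exact_mod_cast hpq
  have gen : ∀ a : ℕ, Int.gcd ((a : ℤ) * p) q * (m * h * y) =
      q.natAbs * Nat.gcd (a * (k * z)) (m * h * y) := by
    intro a
    have e : ((a : ℤ) * p).natAbs * (m * h * y) = q.natAbs * (a * (k * z)) := by
      have := congrArg Int.natAbs hpq'
      simp only [Int.natAbs_mul, Int.natAbs_neg, Int.natAbs_natCast] at this ⊢
      rw [mul_assoc, this]
      ring
    rw [Int.gcd_def, ← Nat.gcd_mul_right, e, Nat.gcd_mul_left]
  have g1 := gen (m * h)
  have g2 := gen h
  have hqa : ((q.natAbs : ℕ) : ℚ) = q := by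
    rw [Nat.cast_natAbs, abs_of_pos hq]
  have g1Q := congrArg (Nat.cast : ℕ → ℚ) g1
  have g2Q := congrArg (Nat.cast : ℕ → ℚ) g2
  have keyQ := congrArg (Nat.cast : ℕ → ℚ) key
  push_cast [-Nat.cast_natAbs] at g1Q g2Q keyQ
  rw [hqa] at g1Q g2Q
  generalize (Int.gcd ((m : ℤ) * h * p) q : ℚ) = A at *
  generalize (Int.gcd ((h : ℤ) * p) q : ℚ) = B at *
  generalize (Nat.gcd (m * h * (k * z)) (m * h * y) : ℚ) = C at *
  generalize (Nat.gcd (h * (k * z)) (m * h * y) : ℚ) = D at *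
  have hAB : A * B * ((m : ℚ) * h * y) ^ 2 = q ^ 2 * (k * m * h ^ 2) := by
    rw [← keyQ]
    linear_combination (B * ((m : ℚ) * h * y)) * g1Q + (q * C) * g2Q
  rw [div_eq_div_iff (by positivity) (by positivity)]
  linear_combination (-(h : ℚ) ^ 2) * hAB
end

section
/- For all positive integers m and n, the following three sets coincide: Ex(m) ∩ Ex(m·n); the set {k ∈ Ex(m) : gcd(k, n) = 1}; and the set {k ∈ Ex(m·n) : k ∣ m}. -/
/-- `Ex m` is the set of exact divisors of `m`: divisors `k` of `m` with
`gcd(k, m/k) = 1`. -/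
def ExDiv (m : ℕ) : Set ℕ := {k | k ∣ m ∧ Nat.gcd k (m / k) = 1}

/-- For all positive integers `m` and `n`, the sets `Ex(m) ∩ Ex(m·n)`,
`{k ∈ Ex(m) : gcd(k, n) = 1}` and `{k ∈ Ex(m·n) : k ∣ m}` coincide. -/
theorem exDiv_inter_eq (m n : ℕ) (hm : 0 < m) (hn : 0 < n) :
    ExDiv m ∩ ExDiv (m * n) = {k ∈ ExDiv m | Nat.gcd k n = 1} ∧
    ExDiv m ∩ ExDiv (m * n) = {k ∈ ExDiv (m * n) | k ∣ m} := by
  have key : ∀ k, k ∣ m → (Nat.gcd k (m * n / k) = 1 ↔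
      Nat.gcd k (m / k) = 1 ∧ Nat.gcd k n = 1) := by
    intro k hk
    rw [Nat.mul_div_right_comm hk n]
    exact Nat.coprime_mul_iff_right
  constructor
  · ext k
    simp only [ExDiv, Set.mem_inter_iff, Set.mem_setOf_eq]
    constructor
    · rintro ⟨⟨h1, h2⟩, _, h4⟩
      exact ⟨⟨h1, h2⟩, ((key k h1).1 h4).2⟩
    · rintro ⟨⟨h1, h2⟩, h3⟩
      exact ⟨⟨h1, h2⟩, h1.mul_right n, (key k h1).2 ⟨h2, h3⟩⟩
  · ext k
    simp only [ExDiv, Set.mem_inter_iff, Set.mem_setOf_eq]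
    constructor
    · rintro ⟨⟨h1, _⟩, h3⟩
      exact ⟨h3, h1⟩
    · rintro ⟨⟨h1, h2⟩, h3⟩
      exact ⟨⟨h3, ((key k h3).1 h2).1⟩, h1, h2⟩
end

section
/- Let m and h be positive integers, and let k be an exact divisor of m·h². If h ∣ k, then h² ∣ k. -/
/-- Let `m`, `h` be positive integers and `k` an exact divisor of `m·h²`
(that is, `k ∣ m·h²` and `gcd(k, m·h²/k) = 1`). If `h ∣ k` then `h² ∣ k`. -/
theorem sq_dvd_of_exact_divisor (m h k : ℕ) (hm : 0 < m) (hh : 0 < h)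
    (hk : k ∣ m * h ^ 2) (hcop : Nat.gcd k (m * h ^ 2 / k) = 1)
    (hdvd : h ∣ k) : h ^ 2 ∣ k := by
  have h1 : Nat.Coprime (h ^ 2) (m * h ^ 2 / k) :=
    Nat.Coprime.pow_left 2 (Nat.Coprime.coprime_dvd_left hdvd hcop)
  apply h1.dvd_of_dvd_mul_right
  rw [Nat.mul_div_cancel' hk]
  exact Dvd.intro_left m rfl
end
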